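/- Assume that for every cardinal χ there is a cardinal μ with μ →_{BG} (c)^{<ω}_χ. Then for every infinite cardinal λ, h(L^{wo}_{λ⁺,ω}) < h(L^c_{λ⁺,ω}). -/

import Mathlib

open FirstOrder Cardinal

namespace Hanf

/-- Formulas of (extensions of) infinitary first-order logic over a vocabulary `L`:
first-order logic with equality, infinitary conjunctions, monadic second-order
(set) variables, binary relation variables, and the quantifiers
`wo` (well-ordering), `∃^c` (countable set), `aa` (stationary), `∃R` (second order),
and `Q^{cf}_{ℵ₀}` (countable cofinality). -/
inductive Fml (L : FirstOrder.Language.{0,0}) : Type 1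
  | rel : {n : ℕ} → L.Relations n → (Fin n → L.Term ℕ) → Fml L
  | eq : L.Term ℕ → L.Term ℕ → Fml L
  | mem : ℕ → L.Term ℕ → Fml L
  | rmem : ℕ → L.Term ℕ → L.Term ℕ → Fml L
  | not : Fml L → Fml L
  | conj : (ι : Type) → (ι → Fml L) → Fml L
  | all : ℕ → Fml L → Fml L
  | qWo : ℕ → ℕ → Fml L → Fml L
  | qC : ℕ → Fml L → Fml L
  | qAA : ℕ → Fml L → Fml L
  | qII : ℕ → Fml L → Fml L
  | qCf : ℕ → ℕ → Fml L → Fml L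

variable {L : FirstOrder.Language.{0,0}}

/-- A family of countable subsets of `M` which is closed under unions of countable
increasing chains and cofinal (under `⊆`) in the countable subsets of `M`. -/
def IsClubFam {M : Type} (C : Set (Set M)) : Prop :=
  (∀ S ∈ C, S.Countable) ∧
  (∀ f : ℕ → Set M, (∀ n, f n ∈ C) → Monotone f → (⋃ n, f n) ∈ C) ∧
  (∀ S : Set M, S.Countable → ∃ T ∈ C, S ⊆ T)

/-- The field of a binary relation. -/
def fieldOf {M : Type} (r : M → M → Prop) : Set M :=
  {a | (∃ b, r a b) ∨ ∃ b, r b a}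

/-- `r` well-orders its field. -/
def WellOrdersField {M : Type} (r : M → M → Prop) : Prop :=
  IsWellOrder (fieldOf r) (fun a b => r a.1 b.1)

/-- `r` is a linear order of its field, of cofinality `ℵ₀`:
it is irreflexive, transitive and trichotomous on its field, some countable
sequence is cofinal in it, and it has no maximal element. -/
def LinearOrdersFieldCofOmega {M : Type} (r : M → M → Prop) : Prop :=
  (∀ a ∈ fieldOf r, ¬ r a a) ∧
  (∀ a ∈ fieldOf r, ∀ b ∈ fieldOf r, ∀ c ∈ fieldOf r, r a b → r b c → r a c) ∧
  (∀ a ∈ fieldOf r, ∀ b ∈ fieldOf r, a ≠ b → r a b ∨ r b a) ∧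
  (∃ c : ℕ → M, (∀ n, c n ∈ fieldOf r) ∧ ∀ a ∈ fieldOf r, ∃ n, a = c n ∨ r a (c n)) ∧
  (∀ a ∈ fieldOf r, ∃ b ∈ fieldOf r, r a b)

/-- Satisfaction, relative to assignments of the first-order variables,
the monadic (set) variables and the binary relation variables. -/
def Eval {M : Type} [L.Structure M] :
    Fml L → (ℕ → M) → (ℕ → Set M) → (ℕ → M → M → Prop) → Prop
  | .rel R ts, va, _, _ => Language.Structure.RelMap R (fun i => (ts i).realize va)
  | .eq t₁ t₂, va, _, _ => t₁.realize va = t₂.realize va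
  | .mem X t, va, vs, _ => t.realize va ∈ vs X
  | .rmem R t₁ t₂, va, _, vr => vr R (t₁.realize va) (t₂.realize va)
  | .not φ, va, vs, vr => ¬ Eval φ va vs vr
  | .conj _ f, va, vs, vr => ∀ i, Eval (f i) va vs vr
  | .all x φ, va, vs, vr => ∀ a, Eval φ (Function.update va x a) vs vr
  | .qWo x y φ, va, vs, vr =>
      WellOrdersField (fun a b =>
        Eval φ (Function.update (Function.update va x a) y b) vs vr)
  | .qC X φ, va, vs, vr => ∃ S : Set M, S.Countable ∧ Eval φ va (Function.update vs X S) vr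
  | .qAA X φ, va, vs, vr =>
      ∃ C : Set (Set M), IsClubFam C ∧ ∀ S ∈ C, Eval φ va (Function.update vs X S) vr
  | .qII R φ, va, vs, vr => ∃ r : M → M → Prop, Eval φ va vs (Function.update vr R r)
  | .qCf x y φ, va, vs, vr =>
      LinearOrdersFieldCofOmega (fun a b =>
        Eval φ (Function.update (Function.update va x a) y b) vs vr)

/-- The variables of a term. -/
def tvars : L.Term ℕ → Set ℕ
  | .var i => {i}
  | .func _ ts => ⋃ i, tvars (ts i)

/-- Free first-order variables. -/
def fv : Fml L → Set ℕ
  | .rel _ ts => ⋃ i, tvars (ts i)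
  | .eq t₁ t₂ => tvars t₁ ∪ tvars t₂
  | .mem _ t => tvars t
  | .rmem _ t₁ t₂ => tvars t₁ ∪ tvars t₂
  | .not φ => fv φ
  | .conj _ f => ⋃ i, fv (f i)
  | .all x φ => fv φ \ {x}
  | .qWo x y φ => fv φ \ {x, y}
  | .qC _ φ => fv φ
  | .qAA _ φ => fv φ
  | .qII _ φ => fv φ
  | .qCf x y φ => fv φ \ {x, y}

/-- Free monadic (set) variables. -/
def sv : Fml L → Set ℕ
  | .rel _ _ => ∅
  | .eq _ _ => ∅
  | .mem X _ => {X}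
  | .rmem _ _ _ => ∅
  | .not φ => sv φ
  | .conj _ f => ⋃ i, sv (f i)
  | .all _ φ => sv φ
  | .qWo _ _ φ => sv φ
  | .qC X φ => sv φ \ {X}
  | .qAA X φ => sv φ \ {X}
  | .qII _ φ => sv φ
  | .qCf _ _ φ => sv φ

/-- Free binary relation variables. -/
def rv : Fml L → Set ℕ
  | .rel _ _ => ∅
  | .eq _ _ => ∅
  | .mem _ _ => ∅
  | .rmem R _ _ => {R}
  | .not φ => rv φ
  | .conj _ f => ⋃ i, rv (f i)
  | .all _ φ => rv φ
  | .qWo _ _ φ => rv φ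
  | .qC _ φ => rv φ
  | .qAA _ φ => rv φ
  | .qII R φ => rv φ \ {R}
  | .qCf _ _ φ => rv φ

/-- A sentence: no free variables of any kind. -/
def IsSentence (φ : Fml L) : Prop := fv φ = ∅ ∧ sv φ = ∅ ∧ rv φ = ∅

/-- Which extra quantifiers a logic allows, and the bound on the size
of its conjunctions (`conjBound = ℵ₀` gives finitary logic). -/
structure Allowed where
  wo : Prop
  c : Prop
  aa : Prop
  ii : Prop
  cf : Prop
  conjBound : Cardinal.{0}

/-- The formula lies in the logic described by `A`. -/
def Ok (A : Allowed) : Fml L → Prop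
  | .rel _ _ => True
  | .eq _ _ => True
  | .mem _ _ => True
  | .rmem _ _ _ => True
  | .not φ => Ok A φ
  | .conj ι f => #ι < A.conjBound ∧ ∀ i, Ok A (f i)
  | .all _ φ => Ok A φ
  | .qWo _ _ φ => A.wo ∧ Ok A φ
  | .qC _ φ => A.c ∧ Ok A φ
  | .qAA _ φ => A.aa ∧ Ok A φ
  | .qII _ φ => A.ii ∧ Ok A φ
  | .qCf _ _ φ => A.cf ∧ Ok A φ

/-- `M ⊨ φ` (for sentences this does not depend on the assignments). -/
def Sat (M : Type) [L.Structure M] (φ : Fml L) : Prop :=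
  ∀ (va : ℕ → M) (vs : ℕ → Set M) (vr : ℕ → M → M → Prop), Eval φ va vs vr

/-- `h(φ) < ∞`: `φ` has no models of arbitrarily large cardinality. -/
def BddSpec (φ : Fml L) : Prop :=
  ∃ κ : Cardinal, ∀ (M : Type) (S : L.Structure M), @Sat L M S φ → #M < κ

/-- The Hanf value `h(φ) = sup {|M|⁺ : M ⊨ φ}`. -/
noncomputable def hanfVal (φ : Fml L) : Cardinal :=
  sSup {c | ∃ (M : Type) (S : L.Structure M), @Sat L M S φ ∧ c = Order.succ #M}

/-- The Hanf number of the logic `A`: the supremum of `h(φ)` over all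
sentences `φ` of the logic (in any vocabulary) with `h(φ) < ∞`. -/
noncomputable def hanfNum (A : Allowed) : Cardinal :=
  sSup {c | ∃ (L : FirstOrder.Language.{0,0}) (φ : Fml L),
    IsSentence φ ∧ Ok A φ ∧ BddSpec φ ∧ c = hanfVal φ}

/-- The Hanf number of the logic `A` computed over vocabularies of cardinality `≤ χ`. -/
noncomputable def hanfNumVocab (A : Allowed) (χ : Cardinal) : Cardinal :=
  sSup {c | ∃ (L : FirstOrder.Language.{0,0}), L.card ≤ χ ∧ ∃ φ : Fml L,
    IsSentence φ ∧ Ok A φ ∧ BddSpec φ ∧ c = hanfVal φ}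

/-- `L^{wo}_{ω,ω}`. -/
def Lwo : Allowed := ⟨True, False, False, False, False, ℵ₀⟩
/-- `L^c_{ω,ω}`. -/
def Lc : Allowed := ⟨False, True, False, False, False, ℵ₀⟩
/-- `L^{aa}_{ω,ω}`. -/
def Laa : Allowed := ⟨False, False, True, False, False, ℵ₀⟩
/-- `L^{II}_{ω,ω}`. -/
def LII : Allowed := ⟨False, False, False, True, False, ℵ₀⟩
/-- `L_{ω,ω}(Q^{cf}_{ℵ₀})`. -/
def Lcf : Allowed := ⟨False, False, False, False, True, ℵ₀⟩
/-- `L^{wo}_{κ,ω}`: conjunctions of `< κ` formulas. -/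
def LwoInf (κ : Cardinal) : Allowed := ⟨True, False, False, False, False, κ⟩
/-- `L^c_{κ,ω}`. -/
def LcInf (κ : Cardinal) : Allowed := ⟨False, True, False, False, False, κ⟩
/-- `L^{II}_{κ,ω}`. -/
def LIIInf (κ : Cardinal) : Allowed := ⟨False, False, False, True, False, κ⟩


/-- The Baumgartner–Galvin partition relation `μ →_{BG} (c)^{<ω}_χ`:
for every coloring `f` of the finite subsets of `μ` with `χ` colors there is a
sequence `⟨γ_n : n < ω⟩` of colors such that for every `α < ω₁` there is a
set `Y` of order type `α` with `f(w) = γ_n` for every `n`-element subset `w` of `Y`. -/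
def BGPartition (μ χ : Cardinal.{0}) : Prop :=
  ∀ f : Finset ↥(Set.Iio μ.ord) → ↥(Set.Iio χ.ord),
    ∃ γ : ℕ → ↥(Set.Iio χ.ord),
      ∀ α : Ordinal.{0}, α < (Cardinal.aleph.{0} 1).ord →
        ∃ Y : Set ↥(Set.Iio μ.ord),
          Nonempty (↥(Set.Iio α) ≃o ↥Y) ∧
          ∀ (n : ℕ) (w : Finset ↥(Set.Iio μ.ord)), ↑w ⊆ Y → w.card = n → f w = γ n

/-- The ordinary partition relation `μ → (ω₁)^{<ω}_χ`. -/
def OrdPartition (μ χ : Cardinal.{0}) : Prop :=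
  ∀ f : Finset ↥(Set.Iio μ.ord) → ↥(Set.Iio χ.ord),
    ∃ H : Set ↥(Set.Iio μ.ord),
      Nonempty (↥(Set.Iio (Cardinal.aleph.{0} 1).ord) ≃o ↥H) ∧
      ∀ w w' : Finset ↥(Set.Iio μ.ord), ↑w ⊆ H → ↑w' ⊆ H → w.card = w'.card → f w = f w'

end Hanf

section PartPA
open FirstOrder Cardinal
namespace Hanf

section Basics
variable {L : FirstOrder.Language.{0,0}}

theorem realize_congr_tvars {M : Type} [L.Structure M] (t : L.Term ℕ) (va va' : ℕ → M)
    (h : ∀ k ∈ tvars t, va k = va' k) : t.realize va = t.realize va' := by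
  induction t with
  | var i => exact h i (by simp [tvars])
  | func f ts ih =>
    simp only [Language.Term.realize]
    congr 1
    funext i
    exact ih i (fun k hk => h k (by simp only [tvars, Set.mem_iUnion]; exact ⟨i, hk⟩))

/-- Satisfaction depends only on the free variables. -/
theorem eval_congr {M : Type} [L.Structure M] (φ : Fml L) : ∀ (va va' : ℕ → M)
    (vs vs' : ℕ → Set M) (vr vr' : ℕ → M → M → Prop),
    (∀ k ∈ fv φ, va k = va' k) → (∀ k ∈ sv φ, vs k = vs' k) → (∀ k ∈ rv φ, vr k = vr' k) →
    (Eval φ va vs vr ↔ Eval φ va' vs' vr') := by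
  induction φ with
  | rel R ts =>
    intro va va' vs vs' vr vr' h1 h2 h3
    simp only [Eval]
    have : (fun i => (ts i).realize va) = (fun i => (ts i).realize va') := by
      funext i
      exact realize_congr_tvars _ _ _ (fun k hk => h1 k (by
        simp only [fv, Set.mem_iUnion]; exact ⟨i, hk⟩))
    rw [this]
  | eq t₁ t₂ =>
    intro va va' vs vs' vr vr' h1 h2 h3
    simp only [Eval]
    rw [realize_congr_tvars t₁ va va' (fun k hk => h1 k (Or.inl hk)),
      realize_congr_tvars t₂ va va' (fun k hk => h1 k (Or.inr hk))]
  | mem X t =>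
    intro va va' vs vs' vr vr' h1 h2 h3
    simp only [Eval]
    rw [realize_congr_tvars t va va' (fun k hk => h1 k hk), h2 X (by simp [sv])]
  | rmem R t₁ t₂ =>
    intro va va' vs vs' vr vr' h1 h2 h3
    simp only [Eval]
    rw [realize_congr_tvars t₁ va va' (fun k hk => h1 k (Or.inl hk)),
      realize_congr_tvars t₂ va va' (fun k hk => h1 k (Or.inr hk)), h3 R (by simp [rv])]
  | not φ ih =>
    intro va va' vs vs' vr vr' h1 h2 h3
    simp only [Eval]
    rw [ih va va' vs vs' vr vr' h1 h2 h3]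
  | conj ι f ih =>
    intro va va' vs vs' vr vr' h1 h2 h3
    simp only [Eval]
    refine forall_congr' fun i => ih i va va' vs vs' vr vr' ?_ ?_ ?_
    · exact fun k hk => h1 k (by simp only [fv, Set.mem_iUnion]; exact ⟨i, hk⟩)
    · exact fun k hk => h2 k (by simp only [sv, Set.mem_iUnion]; exact ⟨i, hk⟩)
    · exact fun k hk => h3 k (by simp only [rv, Set.mem_iUnion]; exact ⟨i, hk⟩)
  | all x φ ih =>
    intro va va' vs vs' vr vr' h1 h2 h3
    simp only [Eval]
    refine forall_congr' fun a => ih _ _ vs vs' vr vr' ?_ h2 h3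
    intro k hk
    by_cases hx : k = x
    · subst hx; simp
    · simp only [Function.update_of_ne hx]
      exact h1 k ⟨hk, hx⟩
  | qWo x y φ ih =>
    intro va va' vs vs' vr vr' h1 h2 h3
    simp only [Eval]
    have : (fun a b => Eval φ (Function.update (Function.update va x a) y b) vs vr) =
        (fun a b => Eval φ (Function.update (Function.update va' x a) y b) vs' vr') := by
      funext a b
      refine propext (ih _ _ vs vs' vr vr' ?_ h2 h3)
      intro k hk
      by_cases hy : k = y
      · subst hy; simp
      · by_cases hx : k = x
        · subst hx; simp [Function.update_of_ne hy]
        · simp only [Function.update_of_ne hx, Function.update_of_ne hy]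
          exact h1 k ⟨hk, by simp [hx, hy]⟩
    rw [this]
  | qC X φ ih =>
    intro va va' vs vs' vr vr' h1 h2 h3
    simp only [Eval]
    refine exists_congr fun S => and_congr_right fun _ => ih _ _ _ _ vr vr' h1 ?_ h3
    intro k hk
    by_cases hx : k = X
    · subst hx; simp
    · simp only [Function.update_of_ne hx]
      exact h2 k ⟨hk, hx⟩
  | qAA X φ ih =>
    intro va va' vs vs' vr vr' h1 h2 h3
    simp only [Eval]
    refine exists_congr fun C => and_congr_right fun _ => forall_congr' fun S =>
      forall_congr' fun _ => ih _ _ _ _ vr vr' h1 ?_ h3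
    intro k hk
    by_cases hx : k = X
    · subst hx; simp
    · simp only [Function.update_of_ne hx]
      exact h2 k ⟨hk, hx⟩
  | qII R φ ih =>
    intro va va' vs vs' vr vr' h1 h2 h3
    simp only [Eval]
    refine exists_congr fun S => ih _ _ vs vs' _ _ h1 h2 ?_
    intro k hk
    by_cases hx : k = R
    · subst hx; simp
    · simp only [Function.update_of_ne hx]
      exact h3 k ⟨hk, hx⟩
  | qCf x y φ ih =>
    intro va va' vs vs' vr vr' h1 h2 h3
    simp only [Eval]
    have : (fun a b => Eval φ (Function.update (Function.update va x a) y b) vs vr) =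
        (fun a b => Eval φ (Function.update (Function.update va' x a) y b) vs' vr') := by
      funext a b
      refine propext (ih _ _ vs vs' vr vr' ?_ h2 h3)
      intro k hk
      by_cases hy : k = y
      · subst hy; simp
      · by_cases hx : k = x
        · subst hx; simp [Function.update_of_ne hy]
        · simp only [Function.update_of_ne hx, Function.update_of_ne hy]
          exact h1 k ⟨hk, by simp [hx, hy]⟩
    rw [this]

theorem sat_of_eval {M : Type} [L.Structure M] {φ : Fml L} (hφ : IsSentence φ)
    {va : ℕ → M} {vs : ℕ → Set M} {vr : ℕ → M → M → Prop} (h : Eval φ va vs vr) : Sat M φ := by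
  intro va' vs' vr'
  refine (eval_congr φ va va' vs vs' vr vr' ?_ ?_ ?_).1 h
  · simp [hφ.1]
  · simp [hφ.2.1]
  · simp [hφ.2.2]

end Basics

/-! ### Codes: a small universal set of formulas -/

/-- The universal vocabulary on the index type `Λ`. -/
def LS (Λ : Type) : FirstOrder.Language.{0,0} := ⟨fun _ => Λ, fun _ => Λ⟩

/-- Codes of formulas. -/
inductive Code (Λ : Type) : Type
  | rel : (n : ℕ) → Λ → (Fin n → (LS Λ).Term ℕ) → Code Λ
  | eq : (LS Λ).Term ℕ → (LS Λ).Term ℕ → Code Λ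
  | mem : ℕ → (LS Λ).Term ℕ → Code Λ
  | rmem : ℕ → (LS Λ).Term ℕ → (LS Λ).Term ℕ → Code Λ
  | not : Code Λ → Code Λ
  | conj : Set Λ → (Λ → Code Λ) → Code Λ
  | all : ℕ → Code Λ → Code Λ
  | wo : ℕ → ℕ → Code Λ → Code Λ
  | c : ℕ → Code Λ → Code Λ

variable {Λ : Type}

/-- The formula coded by a code. -/
def Code.dec : Code Λ → Fml (LS Λ)
  | .rel n R ts => .rel (L := LS Λ) (n := n) R ts
  | .eq t s => .eq t s
  | .mem X t => .mem X t
  | .rmem R t s => .rmem R t s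
  | .not φ => .not φ.dec
  | .conj s f => .conj s (fun i => (f i.1).dec)
  | .all x φ => .all x φ.dec
  | .wo x y φ => .qWo x y φ.dec
  | .c X φ => .qC X φ.dec

/-- No second-order variables are mentioned. -/
def NoSet : Code Λ → Prop
  | .rel _ _ _ => True
  | .eq _ _ => True
  | .mem _ _ => False
  | .rmem _ _ _ => False
  | .not φ => NoSet φ
  | .conj s f => ∀ i ∈ s, NoSet (f i)
  | .all _ φ => NoSet φ
  | .wo _ _ φ => NoSet φ
  | .c _ _ => False

section Used
variable {L : FirstOrder.Language.{0,0}}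

/-- Function symbols used in a term. -/
def uT : L.Term ℕ → Set (Σ n, L.Functions n)
  | .var _ => ∅
  | .func (l := n) f ts => insert ⟨n, f⟩ (⋃ i, uT (ts i))

/-- Function symbols used in a formula. -/
def uF : Fml L → Set (Σ n, L.Functions n)
  | .rel _ ts => ⋃ i, uT (ts i)
  | .eq t₁ t₂ => uT t₁ ∪ uT t₂
  | .mem _ t => uT t
  | .rmem _ t₁ t₂ => uT t₁ ∪ uT t₂
  | .not φ => uF φ
  | .conj _ f => ⋃ i, uF (f i)
  | .all _ φ => uF φ
  | .qWo _ _ φ => uF φ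
  | .qC _ φ => uF φ
  | .qAA _ φ => uF φ
  | .qII _ φ => uF φ
  | .qCf _ _ φ => uF φ

/-- Relation symbols used in a formula. -/
def uR : Fml L → Set (Σ n, L.Relations n)
  | .rel (n := n) R _ => {⟨n, R⟩}
  | .eq _ _ => ∅
  | .mem _ _ => ∅
  | .rmem _ _ _ => ∅
  | .not φ => uR φ
  | .conj _ f => ⋃ i, uR (f i)
  | .all _ φ => uR φ
  | .qWo _ _ φ => uR φ
  | .qC _ φ => uR φ
  | .qAA _ φ => uR φ
  | .qII _ φ => uR φ
  | .qCf _ _ φ => uR φ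

theorem uT_finite (t : L.Term ℕ) : (uT t).Finite := by
  induction t with
  | var i => simp [uT]
  | func f ts ih =>
    simp only [uT]
    exact (Set.finite_iUnion ih).insert _

theorem card_le_of_finite {α : Type} {s : Set α} (hs : s.Finite) {lam : Cardinal.{0}}
    (hl : ℵ₀ ≤ lam) : #s ≤ lam := by
  have := hs.lt_aleph0
  exact this.le.trans hl

theorem mk_iUnion_le_of {α ι : Type} {lam : Cardinal.{0}} (hl : ℵ₀ ≤ lam) (hι : #ι ≤ lam)
    (f : ι → Set α) (hf : ∀ i, #(f i) ≤ lam) : #(⋃ i, f i) ≤ lam := by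
  refine (mk_iUnion_le_sum_mk).trans ?_
  refine (Cardinal.sum_le_sum _ (fun _ => lam) hf).trans ?_
  rw [Cardinal.sum_const']
  exact (mul_le_mul_left hι _).trans (mul_eq_self hl).le

theorem uF_card {lam : Cardinal.{0}} (hl : ℵ₀ ≤ lam) {A : Allowed}
    (hA : A.conjBound = Order.succ lam) (φ : Fml L) (hok : Ok A φ) : #(uF φ) ≤ lam := by
  induction φ with
  | rel R ts => exact card_le_of_finite (Set.finite_iUnion fun i => uT_finite _) hl
  | eq t₁ t₂ => exact card_le_of_finite ((uT_finite _).union (uT_finite _)) hl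
  | mem X t => exact card_le_of_finite (uT_finite _) hl
  | rmem R t₁ t₂ => exact card_le_of_finite ((uT_finite _).union (uT_finite _)) hl
  | not φ ih => exact ih hok
  | conj ι f ih =>
    refine mk_iUnion_le_of hl ?_ _ fun i => ih i (hok.2 i)
    have := hok.1
    rw [hA] at this
    exact Order.lt_succ_iff.1 this
  | all x φ ih => exact ih hok
  | qWo x y φ ih => exact ih hok.2
  | qC X φ ih => exact ih hok.2
  | qAA X φ ih => exact ih hok.2
  | qII R φ ih => exact ih hok.2
  | qCf x y φ ih => exact ih hok.2

theorem uR_card {lam : Cardinal.{0}} (hl : ℵ₀ ≤ lam) {A : Allowed}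
    (hA : A.conjBound = Order.succ lam) (φ : Fml L) (hok : Ok A φ) : #(uR φ) ≤ lam := by
  induction φ with
  | rel R ts => exact card_le_of_finite (Set.finite_singleton _) hl
  | eq t₁ t₂ => exact card_le_of_finite Set.finite_empty hl
  | mem X t => exact card_le_of_finite Set.finite_empty hl
  | rmem R t₁ t₂ => exact card_le_of_finite Set.finite_empty hl
  | not φ ih => exact ih hok
  | conj ι f ih =>
    refine mk_iUnion_le_of hl ?_ _ fun i => ih i (hok.2 i)
    have := hok.1
    rw [hA] at this
    exact Order.lt_succ_iff.1 this
  | all x φ ih => exact ih hok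
  | qWo x y φ ih => exact ih hok.2
  | qC X φ ih => exact ih hok.2
  | qAA X φ ih => exact ih hok.2
  | qII R φ ih => exact ih hok.2
  | qCf x y φ ih => exact ih hok.2

/-- Translation of terms. -/
def trT (ef : (Σ n, L.Functions n) → Λ) : L.Term ℕ → (LS Λ).Term ℕ
  | .var i => .var i
  | .func (l := n) f ts => .func (L := LS Λ) (l := n) (ef ⟨n, f⟩) (fun i => trT ef (ts i))

theorem realize_trT (ef : (Σ n, L.Functions n) → Λ) {M : Type} (S : L.Structure M)
    (S' : (LS Λ).Structure M) (t : L.Term ℕ)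
    (h : ∀ f ∈ uT t, ∀ x : Fin f.1 → M, S'.funMap (n := f.1) (ef f) x = S.funMap f.2 x)
    (va : ℕ → M) :
    @Language.Term.realize (LS Λ) M S' ℕ va (trT ef t) = @Language.Term.realize L M S ℕ va t := by
  induction t with
  | var i => rfl
  | func f ts ih =>
    simp only [trT, Language.Term.realize]
    have e : (fun i => @Language.Term.realize (LS Λ) M S' ℕ va (trT ef (ts i))) =
        fun i => @Language.Term.realize L M S ℕ va (ts i) := by
      funext i
      refine ih i (fun f hf x => h f ?_ x)
      simp only [uT, Set.mem_insert_iff, Set.mem_iUnion]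
      exact Or.inr ⟨i, hf⟩
    rw [e]
    exact h ⟨_, f⟩ (by simp [uT]) _

/-- Every formula of the logics at hand has a code. -/
theorem exists_code [Nonempty Λ] {A : Allowed} (haa : ¬ A.aa) (hii : ¬ A.ii) (hcf : ¬ A.cf)
    (hb : ∀ ι : Type, #ι < A.conjBound → #ι ≤ #Λ)
    (ef : (Σ n, L.Functions n) → Λ) (er : (Σ n, L.Relations n) → Λ)
    (φ : Fml L) (hok : Ok A φ) :
    ∃ c : Code Λ, (¬ A.c → sv φ = ∅ → rv φ = ∅ → NoSet c) ∧
      ∀ (M : Type) (S : L.Structure M) (S' : (LS Λ).Structure M),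
      (∀ f ∈ uF φ, ∀ x : Fin f.1 → M, S'.funMap (n := f.1) (ef f) x = S.funMap f.2 x) →
      (∀ r ∈ uR φ, ∀ x : Fin r.1 → M, S'.RelMap (n := r.1) (er r) x ↔ S.RelMap r.2 x) →
      ∀ va vs vr, @Eval (LS Λ) M S' c.dec va vs vr ↔ @Eval L M S φ va vs vr := by
  induction φ with
  | @rel n R ts =>
    refine ⟨.rel n (er ⟨n, R⟩) (fun i => trT ef (ts i)), fun _ _ _ => trivial, ?_⟩
    intro M S S' hf hr va vs vr
    simp only [Code.dec, Eval]
    rw [← hr ⟨n, R⟩ (by simp [uR])]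
    have e : (fun i => @Language.Term.realize (LS Λ) M S' ℕ va (trT ef (ts i))) =
        fun i => @Language.Term.realize L M S ℕ va (ts i) := by
      funext i
      refine realize_trT ef S S' _ (fun f hf' => hf f ?_) va
      simp only [uF, Set.mem_iUnion]
      exact ⟨i, hf'⟩
    rw [e]
  | eq t₁ t₂ =>
    refine ⟨.eq (trT ef t₁) (trT ef t₂), fun _ _ _ => trivial, ?_⟩
    intro M S S' hf hr va vs vr
    simp only [Code.dec, Eval]
    rw [realize_trT ef S S' t₁ (fun f hf' => hf f (Or.inl hf')) va,
      realize_trT ef S S' t₂ (fun f hf' => hf f (Or.inr hf')) va]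
  | mem X t =>
    refine ⟨.mem X (trT ef t), fun _ h _ => by simp [sv] at h, ?_⟩
    intro M S S' hf hr va vs vr
    simp only [Code.dec, Eval]
    rw [realize_trT ef S S' t (fun f hf' => hf f hf') va]
  | rmem R t₁ t₂ =>
    refine ⟨.rmem R (trT ef t₁) (trT ef t₂), fun _ _ h => by simp [rv] at h, ?_⟩
    intro M S S' hf hr va vs vr
    simp only [Code.dec, Eval]
    rw [realize_trT ef S S' t₁ (fun f hf' => hf f (Or.inl hf')) va,
      realize_trT ef S S' t₂ (fun f hf' => hf f (Or.inr hf')) va]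
  | not φ ih =>
    obtain ⟨c, hc, h⟩ := ih hok
    refine ⟨.not c, hc, ?_⟩
    intro M S S' hf hr va vs vr
    simp only [Code.dec, Eval]
    rw [h M S S' hf hr]
  | conj ι f ih =>
    choose c hc h using fun i => ih i (hok.2 i)
    obtain ⟨j⟩ : Nonempty (ι ↪ Λ) := Cardinal.le_def _ _ |>.1 (hb ι hok.1)
    classical
    let d : Code Λ := .eq (.var 0) (.var 0)
    let F : Λ → Code Λ := fun l => if hl : ∃ i, j i = l then c hl.choose else d
    have hF : ∀ i, F (j i) = c i := by
      intro i
      have hl : ∃ i', j i' = j i := ⟨i, rfl⟩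
      simp only [F, dif_pos hl]
      rw [j.injective hl.choose_spec]
    refine ⟨.conj (Set.range j) F, ?_, ?_⟩
    · intro h1 h2 h3
      rintro _ ⟨i, rfl⟩
      rw [hF]
      simp only [sv, Set.iUnion_eq_empty] at h2
      simp only [rv, Set.iUnion_eq_empty] at h3
      exact hc i h1 (h2 i) (h3 i)
    · intro M S S' hf hr va vs vr
      simp only [Code.dec, Eval]
      have key : ∀ i, @Eval (LS Λ) M S' (c i).dec va vs vr ↔ @Eval L M S (f i) va vs vr := by
        intro i
        refine h i M S S' (fun f hf' => hf f ?_) (fun r hr' => hr r ?_) va vs vr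
        · simp only [uF, Set.mem_iUnion]; exact ⟨i, hf'⟩
        · simp only [uR, Set.mem_iUnion]; exact ⟨i, hr'⟩
      constructor
      · intro H i
        have := H ⟨j i, i, rfl⟩
        simp only [hF] at this
        exact (key i).1 this
      · rintro H ⟨_, i, rfl⟩
        simp only [hF]
        exact (key i).2 (H i)
  | all x φ ih =>
    obtain ⟨c, hc, h⟩ := ih hok
    refine ⟨.all x c, hc, ?_⟩
    intro M S S' hf hr va vs vr
    simp only [Code.dec, Eval]
    exact forall_congr' fun a => h M S S' hf hr _ _ _
  | qWo x y φ ih =>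
    obtain ⟨c, hc, h⟩ := ih hok.2
    refine ⟨.wo x y c, hc, ?_⟩
    intro M S S' hf hr va vs vr
    simp only [Code.dec, Eval]
    have e : (fun a b => @Eval (LS Λ) M S' c.dec
        (Function.update (Function.update va x a) y b) vs vr) =
        (fun a b => @Eval L M S φ (Function.update (Function.update va x a) y b) vs vr) := by
      funext a b
      exact propext (h M S S' hf hr _ _ _)
    rw [e]
  | qC X φ ih =>
    obtain ⟨c, hc, h⟩ := ih hok.2
    refine ⟨.c X c, fun hn => (hn hok.1).elim, ?_⟩
    intro M S S' hf hr va vs vr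
    simp only [Code.dec, Eval]
    exact exists_congr fun a => and_congr_right fun _ => h M S S' hf hr _ _ _
  | qAA X φ ih => exact (haa hok.1).elim
  | qII R φ ih => exact (hii hok.1).elim
  | qCf x y φ ih => exact (hcf hok.1).elim

theorem exists_enc {α Λ : Type} [Nonempty Λ] (s : Set α) (h : #s ≤ #Λ) :
    ∃ e : α → Λ, Set.InjOn e s := by
  obtain ⟨j⟩ : Nonempty (s ↪ Λ) := Cardinal.le_def _ _ |>.1 h
  classical
  refine ⟨fun a => if h : a ∈ s then j ⟨a, h⟩ else Classical.arbitrary _, ?_⟩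
  intro a ha b hb hab
  simp only [dif_pos ha, dif_pos hb] at hab
  simpa using j.injective hab

/-- Main coding statement: every formula `φ` of the logic is equivalent to a code, on
nonempty universes. -/
theorem code_spec [Nonempty Λ] {lam : Cardinal.{0}} (hl : ℵ₀ ≤ lam) (hΛ : #Λ = lam)
    {A : Allowed} (haa : ¬ A.aa) (hii : ¬ A.ii) (hcf : ¬ A.cf)
    (hA : A.conjBound = Order.succ lam) (φ : Fml L) (hok : Ok A φ) :
    ∃ c : Code Λ, (¬ A.c → sv φ = ∅ → rv φ = ∅ → NoSet c) ∧
      (∀ (M : Type) (S' : (LS Λ).Structure M), ∃ S : L.Structure M, ∀ va vs vr,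
        @Eval (LS Λ) M S' c.dec va vs vr ↔ @Eval L M S φ va vs vr) ∧
      (∀ (M : Type) [Nonempty M] (S : L.Structure M), ∃ S' : (LS Λ).Structure M, ∀ va vs vr,
        @Eval (LS Λ) M S' c.dec va vs vr ↔ @Eval L M S φ va vs vr) := by
  obtain ⟨ef, hef⟩ := exists_enc (Λ := Λ) (uF φ) (by rw [hΛ]; exact uF_card hl hA φ hok)
  obtain ⟨er, her⟩ := exists_enc (Λ := Λ) (uR φ) (by rw [hΛ]; exact uR_card hl hA φ hok)
  obtain ⟨c, hc, h⟩ := exists_code (Λ := Λ) haa hii hcf (fun ι hι => by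
    rw [hΛ]; rw [hA] at hι; exact Order.lt_succ_iff.1 hι) ef er φ hok
  refine ⟨c, hc, ?_, ?_⟩
  · intro M S'
    exact ⟨⟨fun {n} f x => S'.funMap (n := n) (ef ⟨n, f⟩) x,
      fun {n} r x => S'.RelMap (n := n) (er ⟨n, r⟩) x⟩,
      h M _ S' (fun _ _ _ => rfl) (fun _ _ _ => Iff.rfl)⟩
  · intro M _ S
    classical
    refine ⟨⟨fun {n} l x => if hf : ∃ f : L.Functions n, (⟨n, f⟩ : Σ n, L.Functions n) ∈ uF φ ∧
        ef ⟨n, f⟩ = l then S.funMap hf.choose x else Classical.arbitrary _,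
      fun {n} l x => ∃ r : L.Relations n, (⟨n, r⟩ : Σ n, L.Relations n) ∈ uR φ ∧
        er ⟨n, r⟩ = l ∧ S.RelMap r x⟩, h M S _ ?_ ?_⟩
    · rintro ⟨n, f⟩ hf x
      have hx : ∃ f' : L.Functions n, (⟨n, f'⟩ : Σ n, L.Functions n) ∈ uF φ ∧
        ef ⟨n, f'⟩ = ef ⟨n, f⟩ := ⟨f, hf, rfl⟩
      have e : hx.choose = f := by
        have := hef hx.choose_spec.1 hf hx.choose_spec.2
        simpa using this
      change (if hf : ∃ f' : L.Functions n, (⟨n, f'⟩ : Σ n, L.Functions n) ∈ uF φ ∧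
        ef ⟨n, f'⟩ = ef ⟨n, f⟩ then S.funMap hf.choose x else Classical.arbitrary _) = _
      rw [dif_pos hx, e]
    · rintro ⟨n, r⟩ hr x
      constructor
      · rintro ⟨r', h1, h2, h3⟩
        have := her h1 hr h2
        have e : r' = r := by simpa using this
        exact e ▸ h3
      · intro hx
        exact ⟨r, hr, rfl, hx⟩

end Used

/-! ### Boundedness of the set defining the Hanf number -/

theorem bddAbove_hanf {lam : Cardinal.{0}} (hl : ℵ₀ ≤ lam) {A : Allowed} (haa : ¬ A.aa)
    (hii : ¬ A.ii) (hcf : ¬ A.cf) (hA : A.conjBound = Order.succ lam) :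
    BddAbove {c | ∃ (L : FirstOrder.Language.{0,0}) (φ : Fml L),
      IsSentence φ ∧ Ok A φ ∧ BddSpec φ ∧ c = hanfVal φ} := by
  let Λ : Type := Quotient.out lam
  have hΛ : #Λ = lam := Cardinal.mk_out lam
  have hne : Nonempty Λ := by
    rw [← Cardinal.mk_ne_zero_iff, hΛ]
    exact (aleph0_pos.trans_le hl).ne'
  let val : Code Λ → Cardinal.{0} := fun c =>
    sSup {d | ∃ (M : Type) (_ : Nonempty M) (S : (LS Λ).Structure M),
      (∀ va vs vr, @Eval (LS Λ) M S c.dec va vs vr) ∧ d = Order.succ #M}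
  refine ⟨⨆ c : Code Λ, max 1 (val c), ?_⟩
  rintro _ ⟨L, φ, hs, hok, ⟨κ, hκ⟩, rfl⟩
  obtain ⟨c, -, h1, h2⟩ := code_spec hl hΛ haa hii hcf hA φ hok
  refine le_trans ?_ (le_ciSup Cardinal.bddAbove_of_small c)
  refine csSup_le' ?_
  rintro _ ⟨M, S, hS, rfl⟩
  rcases isEmpty_or_nonempty M with hM | hM
  · refine le_trans ?_ (le_max_left _ _)
    rw [Cardinal.mk_eq_zero]
    simp
  · refine le_trans ?_ (le_max_right _ _)
    obtain ⟨S', hS'⟩ := h2 M S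
    refine le_csSup ⟨κ, ?_⟩ ⟨M, hM, S', fun va vs vr => (hS' va vs vr).2 (hS va vs vr), rfl⟩
    rintro _ ⟨N, hN, T, hT, rfl⟩
    obtain ⟨T', hT'⟩ := h1 N T
    exact Order.succ_le_of_lt (hκ N T' fun va vs vr => (hT' va vs vr).1 (hT va vs vr))

end Hanf
end PartPA

section PartPB
open FirstOrder Cardinal Filter
namespace Hanf
variable {Λ : Type}

/-! ### Ehrenfeucht–Mostowski models -/

/-- Subcodes. -/
def subs : Code Λ → Set (Code Λ)
  | .rel n R ts => {.rel n R ts}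
  | .eq t s => {.eq t s}
  | .mem X t => {.mem X t}
  | .rmem R t s => {.rmem R t s}
  | .not φ => insert (.not φ) (subs φ)
  | .conj s f => insert (.conj s f) (⋃ i, subs (f i))
  | .all x φ => insert (.all x φ) (subs φ)
  | .wo x y φ => insert (.wo x y φ) (subs φ)
  | .c X φ => insert (.c X φ) (subs φ)

theorem self_mem_subs (c : Code Λ) : c ∈ subs c := by
  cases c <;> simp [subs]

theorem subs_subset (c : Code Λ) : ∀ d ∈ subs c, subs d ⊆ subs c := by
  induction c with
  | rel n R ts => intro d hd; simp only [subs, Set.mem_singleton_iff] at hd; subst hd; exact le_rfl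
  | eq t s => intro d hd; simp only [subs, Set.mem_singleton_iff] at hd; subst hd; exact le_rfl
  | mem X t => intro d hd; simp only [subs, Set.mem_singleton_iff] at hd; subst hd; exact le_rfl
  | rmem R t s => intro d hd; simp only [subs, Set.mem_singleton_iff] at hd; subst hd; exact le_rfl
  | not φ ih =>
    intro d hd
    rcases hd with rfl | hd
    · exact le_rfl
    · exact (ih d hd).trans (Set.subset_insert _ _)
  | conj s f ih =>
    intro d hd
    rcases hd with rfl | hd
    · exact le_rfl
    · obtain ⟨i, hi⟩ := Set.mem_iUnion.1 hd
      exact ((ih i d hi).trans (Set.subset_iUnion (fun i => subs (f i)) i)).trans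
        (Set.subset_insert _ _)
  | all x φ ih =>
    intro d hd
    rcases hd with rfl | hd
    · exact le_rfl
    · exact (ih d hd).trans (Set.subset_insert _ _)
  | wo x y φ ih =>
    intro d hd
    rcases hd with rfl | hd
    · exact le_rfl
    · exact (ih d hd).trans (Set.subset_insert _ _)
  | c X φ ih =>
    intro d hd
    rcases hd with rfl | hd
    · exact le_rfl
    · exact (ih d hd).trans (Set.subset_insert _ _)

theorem mk_insert_le_of {α : Type} {s : Set α} {a : α} {lam : Cardinal.{0}} (hl : ℵ₀ ≤ lam)
    (h : #s ≤ lam) : #(insert a s : Set α) ≤ lam :=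
  mk_insert_le.trans (add_le_of_le hl h (one_le_aleph0.trans hl))

theorem subs_card {lam : Cardinal.{0}} (hl : ℵ₀ ≤ lam) (hΛ : #Λ = lam) (c : Code Λ) :
    #(subs c) ≤ lam := by
  induction c with
  | rel n R ts => exact card_le_of_finite (Set.finite_singleton _) hl
  | eq t s => exact card_le_of_finite (Set.finite_singleton _) hl
  | mem X t => exact card_le_of_finite (Set.finite_singleton _) hl
  | rmem R t s => exact card_le_of_finite (Set.finite_singleton _) hl
  | not φ ih => exact mk_insert_le_of hl ih
  | conj s f ih => exact mk_insert_le_of hl (mk_iUnion_le_of hl hΛ.le _ ih)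
  | all x φ ih => exact mk_insert_le_of hl ih
  | wo x y φ ih => exact mk_insert_le_of hl ih
  | c X φ ih => exact mk_insert_le_of hl ih

/-- Satisfaction of a code with trivial second-order assignment. -/
def Ev {M : Type} [(LS Λ).Structure M] (c : Code Λ) (va : ℕ → M) : Prop :=
  Eval c.dec va (fun _ => ∅) (fun _ _ _ => False)

/-- Witness that a relation does not well-order its field. -/
def BadSeq {M : Type} (r : M → M → Prop) (s : ℕ → M) : Prop :=
  (∀ n, r (s (n + 1)) (s n)) ∨
  ((r (s 0) (s 2) ∨ r (s 2) (s 0)) ∧ (r (s 1) (s 3) ∨ r (s 3) (s 1)) ∧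
    ¬ r (s 0) (s 1) ∧ ¬ r (s 1) (s 0) ∧ s 0 ≠ s 1)

theorem not_wof_iff {M : Type} (r : M → M → Prop) :
    ¬ WellOrdersField r ↔ ∃ s, BadSeq r s := by
  constructor
  · intro h
    by_contra hs
    push Not at hs
    apply h
    refine @IsWellOrder.mk _ _ ⟨?_⟩ ⟨?_⟩
    · rw [wellFounded_iff_isEmpty_descending_chain]
      exact ⟨fun f => hs (fun n => (f.1 n).1) (Or.inl fun n => f.2 n)⟩
    · rintro ⟨a, ha⟩ ⟨b, hb⟩ h1 h2
      by_contra hab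
      have hab' : a ≠ b := fun e => hab (Subtype.ext e)
      obtain ⟨a', ha'⟩ : ∃ a', r a a' ∨ r a' a := by
        rcases ha with ⟨x, hx⟩ | ⟨x, hx⟩
        exacts [⟨x, Or.inl hx⟩, ⟨x, Or.inr hx⟩]
      obtain ⟨b', hb'⟩ : ∃ b', r b b' ∨ r b' b := by
        rcases hb with ⟨x, hx⟩ | ⟨x, hx⟩
        exacts [⟨x, Or.inl hx⟩, ⟨x, Or.inr hx⟩]
      refine hs (fun n => if n = 0 then a else if n = 1 then b else if n = 2 then a' else b')
        (Or.inr ⟨?_, ?_, ?_, ?_, ?_⟩) <;> simp <;> assumption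
  · rintro ⟨s, hs⟩ h
    rcases hs with hs | ⟨h0, h1, h2, h3, h4⟩
    · have hf : ∀ n, s n ∈ fieldOf r := fun n => Or.inr ⟨_, hs n⟩
      have wf := h.toIsWellFounded.wf
      have := WellFounded.has_min wf (Set.range fun n => (⟨s n, hf n⟩ : fieldOf r)) ⟨_, 0, rfl⟩
      obtain ⟨_, ⟨n, rfl⟩, hn⟩ := this
      exact hn ⟨s (n + 1), hf _⟩ ⟨n + 1, rfl⟩ (hs n)
    · have f0 : s 0 ∈ fieldOf r := by
        rcases h0 with h | h
        exacts [Or.inl ⟨_, h⟩, Or.inr ⟨_, h⟩]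
      have f1 : s 1 ∈ fieldOf r := by
        rcases h1 with h | h
        exacts [Or.inl ⟨_, h⟩, Or.inr ⟨_, h⟩]
      have := h.toTrichotomous.trichotomous ⟨s 0, f0⟩ ⟨s 1, f1⟩ h2 h3
      exact h4 (congrArg Subtype.val this)

/-- The statement that `w` is a witness of failure of `c` (for quantified codes). -/
def WitOK {M : Type} [(LS Λ).Structure M] : Code Λ → (ℕ → M) → (ℕ → M) → Prop
  | .all x φ, va, w => ¬ Ev φ (Function.update va x (w 0))
  | .wo x y φ, va, w =>
      BadSeq (fun a b => Ev φ (Function.update (Function.update va x a) y b)) w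
  | _, _, _ => True

open Classical in
/-- Skolem functions. -/
noncomputable def Wit {M : Type} [(LS Λ).Structure M] (m0 : M) (c : Code Λ) (va : ℕ → M) : ℕ → M :=
  if h : ∃ w, WitOK c va w then h.choose else fun _ => m0

theorem Wit_spec {M : Type} [(LS Λ).Structure M] (m0 : M) (c : Code Λ) (va : ℕ → M)
    (h : ∃ w, WitOK c va w) : WitOK c va (Wit m0 c va) := by
  unfold Wit
  rw [dif_pos h]
  exact h.choose_spec

/-- The assignment given by finitely many updates. -/
def asg {T : Type} (d : T) : List (ℕ × T) → ℕ → T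
  | [] => fun _ => d
  | q :: l => Function.update (asg d l) q.1 q.2

theorem asg_map {T U : Type} (g : T → U) (d : T) (l : List (ℕ × T)) :
    (fun k => g (asg d l k)) = asg (g d) (l.map (fun q => (q.1, g q.2))) := by
  induction l with
  | nil => rfl
  | cons q l ih =>
    simp only [asg, List.map_cons, ← ih]
    funext k
    by_cases h : k = q.1
    · subst h; simp
    · simp [Function.update_of_ne h]

/-- The Skolem language. -/
def LK (P : Set (Code Λ)) : FirstOrder.Language.{0,0} :=
  ⟨fun n => Option (Λ ⊕ (P × (Fin n → ℕ) × ℕ)), fun _ => Empty⟩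

/-- Interpretation of the Skolem language. -/
@[reducible] noncomputable def KS {M : Type} [(LS Λ).Structure M] (P : Set (Code Λ)) (m0 : M) :
    (LK P).Structure M where
  funMap := fun {n} f x => match f with
    | none => m0
    | some (.inl g) => Language.Structure.funMap (L := LS Λ) (n := n) g x
    | some (.inr (p, v, j)) => Wit m0 p.1 (asg m0 (List.ofFn fun i => (v i, x i))) j
  RelMap := fun _ _ => True

section Core
variable {P : Set (Code Λ)} {I M C : Type} [SM : (LS Λ).Structure M] (m0 : M)
  (v : C → I → M)

/-- Value of a Skolem term. -/
noncomputable def vl (J : C) (t : (LK P).Term I) : M :=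
  @Language.Term.realize (LK P) M (KS P m0) I (v J) t

/-- Substitution of Skolem terms in terms of the base language. -/
def sbt (a : ℕ → (LK P).Term I) : (LS Λ).Term ℕ → (LK P).Term I
  | .var k => a k
  | .func (l := n) f ts => .func (L := LK P) (l := n) (some (.inl f)) (fun i => sbt a (ts i))

theorem vl_sbt (J : C) (a : ℕ → (LK P).Term I) (t : (LS Λ).Term ℕ) :
    vl m0 v J (sbt a t) = t.realize (fun k => vl m0 v J (a k)) := by
  induction t with
  | var k => rfl
  | func f ts ih =>
    simp only [Language.Term.realize, ← ih]
    rfl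

/-- Default term. -/
def dT : (LK P).Term I := .func (L := LK P) (l := 0) none (fun i => i.elim0)

theorem vl_dT (J : C) : vl m0 v J (dT : (LK P).Term I) = m0 := rfl

/-- Skolem term. -/
def skT (p : P) (l : List (ℕ × (LK P).Term I)) (j : ℕ) : (LK P).Term I :=
  .func (L := LK P) (l := l.length) (some (.inr (p, fun i => (l.get i).1, j)))
    (fun i => (l.get i).2)

theorem vl_skT (J : C) (p : P) (l : List (ℕ × (LK P).Term I)) (j : ℕ) :
    vl m0 v J (skT p l j) = Wit m0 p.1 (fun k => vl m0 v J (asg dT l k)) j := by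
  rw [asg_map (vl m0 v J) dT l, vl_dT]
  change Wit m0 p.1 (asg m0 (List.ofFn fun i : Fin l.length =>
    ((l.get i).1, vl m0 v J (l.get i).2))) j = _
  congr 2
  have : (fun i : Fin l.length => ((l.get i).1, vl m0 v J (l.get i).2)) =
    (fun q : ℕ × (LK P).Term I => (q.1, vl m0 v J q.2)) ∘ l.get := rfl
  rw [this, ← List.map_ofFn, List.ofFn_get]

theorem upd_vl (J : C) (l : List (ℕ × (LK P).Term I)) (x : ℕ) (t : (LK P).Term I) :
    Function.update (fun k => vl m0 v J (asg dT l k)) x (vl m0 v J t) =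
      fun k => vl m0 v J (asg dT ((x, t) :: l) k) := by
  funext k
  by_cases h : k = x
  · subst h; simp [asg]
  · simp [asg, Function.update_of_ne h]

variable [Preorder C]

/-- The equivalence relation on Skolem terms. -/
def emS (P : Set (Code Λ)) : Setoid ((LK P).Term I) where
  r t s := ∀ᶠ J in (atTop : Filter C), vl m0 v J t = vl m0 v J s
  iseqv := ⟨fun _ => Eventually.of_forall fun _ => rfl,
    fun h => h.mono fun _ => Eq.symm,
    fun h h' => (h.and h').mono fun _ h => h.1.trans h.2⟩

/-- The Ehrenfeucht–Mostowski model. -/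
def EM (P : Set (Code Λ)) : Type := Quotient (emS m0 v P)

/-- Class of a term. -/
def cl (t : (LK P).Term I) : EM m0 v P := Quotient.mk (emS m0 v P) t

theorem cl_eq {t s : (LK P).Term I} :
    cl m0 v t = cl m0 v s ↔ ∀ᶠ J in (atTop : Filter C), vl m0 v J t = vl m0 v J s := by
  exact (Quotient.eq (r := emS m0 v P)).trans Iff.rfl

theorem cl_surj (q : EM m0 v P) : ∃ t, cl m0 v t = q := Quotient.exists_rep q

/-- Representative. -/
noncomputable def rp (q : EM m0 v P) : (LK P).Term I := (cl_surj m0 v q).choose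

theorem cl_rp (q : EM m0 v P) : cl m0 v (rp m0 v q) = q := (cl_surj m0 v q).choose_spec

noncomputable instance emStr : (LS Λ).Structure (EM m0 v P) where
  funMap := fun {n} f x => cl m0 v (.func (L := LK P) (l := n) (some (.inl f))
    (fun i => rp m0 v (x i)))
  RelMap := fun {n} R x => ∀ᶠ J in (atTop : Filter C),
    SM.RelMap (n := n) R (fun i => vl m0 v J (rp m0 v (x i)))

theorem rp_cl (t : (LK P).Term I) :
    ∀ᶠ J in (atTop : Filter C), vl m0 v J (rp m0 v (cl m0 v t)) = vl m0 v J t :=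
  (cl_eq m0 v).1 (cl_rp m0 v _)

theorem realize_cl (a : ℕ → (LK P).Term I) (t : (LS Λ).Term ℕ) :
    t.realize (fun k => cl m0 v (a k)) = cl m0 v (sbt a t) := by
  induction t with
  | var k => rfl
  | func f ts ih =>
    simp only [Language.Term.realize, ih]
    refine (cl_eq m0 v).2 ?_
    have : ∀ᶠ J in (atTop : Filter C), ∀ i, vl m0 v J (rp m0 v (cl m0 v (sbt a (ts i)))) =
      vl m0 v J (sbt a (ts i)) := eventually_all.2 fun i => rp_cl m0 v _
    refine this.mono fun J hJ => ?_
    have e : (fun i => vl m0 v J (rp m0 v (cl m0 v (sbt a (ts i))))) =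
      fun i => vl m0 v J (sbt a (ts i)) := funext hJ
    exact congrArg (SM.funMap f) e

theorem upd_cl (l : List (ℕ × (LK P).Term I)) (x : ℕ) (t : (LK P).Term I) :
    Function.update (fun k => cl m0 v (asg dT l k)) x (cl m0 v t) =
      fun k => cl m0 v (asg dT ((x, t) :: l) k) := by
  funext k
  by_cases h : k = x
  · subst h; simp [asg]
  · simp [asg, Function.update_of_ne h]

/-- Truth in the Ehrenfeucht–Mostowski model. -/
theorem em_truth [Nonempty C] [IsDirectedOrder C]
    (hcount : ∀ s : ℕ → C, ∃ J, ∀ n, s n ≤ J)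
    (hP : ∀ c ∈ P, subs c ⊆ P) (hE : Code.eq (.var 0) (.var 1) ∈ P)
    (hinv : ∀ l : List (ℕ × (LK P).Term I), ∃ J0 : C, ∀ c ∈ P, ∀ J ≥ J0, ∀ J' ≥ J0,
      Ev c (fun k => vl m0 v J (asg dT l k)) → Ev c (fun k => vl m0 v J' (asg dT l k)))
    (c : Code Λ) : c ∈ P → NoSet c → ∀ l : List (ℕ × (LK P).Term I),
      (Ev c (fun k => cl m0 v (asg dT l k)) ↔
        ∀ᶠ J in (atTop : Filter C), Ev c (fun k => vl m0 v J (asg dT l k))) := by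
  -- the dichotomy
  have dich : ∀ c ∈ P, ∀ l : List (ℕ × (LK P).Term I),
      (¬ ∀ᶠ J in (atTop : Filter C), Ev c (fun k => vl m0 v J (asg dT l k))) →
      ∀ᶠ J in (atTop : Filter C), ¬ Ev c (fun k => vl m0 v J (asg dT l k)) := by
    intro c hc l h
    obtain ⟨J0, hJ0⟩ := hinv l
    refine eventually_atTop.2 ⟨J0, fun J hJ hE => h ?_⟩
    exact eventually_atTop.2 ⟨J0, fun J' hJ' => hJ0 c hc J hJ J' hJ' hE⟩
  have cint : ∀ p : ℕ → C → Prop, (∀ n, ∀ᶠ J in (atTop : Filter C), p n J) →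
      ∀ᶠ J in (atTop : Filter C), ∀ n, p n J := by
    intro p hp
    choose s hs using fun n => eventually_atTop.1 (hp n)
    obtain ⟨J, hJ⟩ := hcount s
    exact eventually_atTop.2 ⟨J, fun J' h n => hs n J' ((hJ n).trans h)⟩
  induction c with
  | rel n R ts =>
    intro hc hn l
    simp only [Ev, Code.dec, Eval, realize_cl]
    have : ∀ᶠ J in (atTop : Filter C), ∀ i, vl m0 v J (rp m0 v (cl m0 v (sbt (asg dT l) (ts i)))) =
      vl m0 v J (sbt (asg dT l) (ts i)) := eventually_all.2 fun i => rp_cl m0 v _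
    refine eventually_congr (this.mono fun J hJ => ?_)
    have e : (fun i => vl m0 v J (rp m0 v (cl m0 v (sbt (asg dT l) (ts i))))) =
      fun i => (ts i).realize (fun k => vl m0 v J (asg dT l k)) := by
      funext i
      rw [hJ i, vl_sbt]
    rw [e]
  | eq t s =>
    intro hc hn l
    simp only [Ev, Code.dec, Eval, realize_cl, cl_eq, vl_sbt]
  | mem X t => intro _ hn; exact hn.elim
  | rmem R t s => intro _ hn; exact hn.elim
  | not φ ih =>
    intro hc hn l
    have hφ : φ ∈ P := hP _ hc (Or.inr (self_mem_subs φ))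
    have := ih hφ hn l
    change ¬ Ev φ _ ↔ ∀ᶠ J in (atTop : Filter C), ¬ Ev φ _
    rw [this]
    refine ⟨dich φ hφ l, fun h h' => ?_⟩
    obtain ⟨J, hJ, hJ'⟩ := (h.and h').exists
    exact hJ hJ'
  | conj s f ih =>
    intro hc hn l
    have hφ : ∀ i, f i ∈ P := fun i => hP _ hc (Or.inr (Set.mem_iUnion.2 ⟨i, self_mem_subs _⟩))
    change (∀ i : s, Ev (f i.1) _) ↔ ∀ᶠ J in (atTop : Filter C), ∀ i : s, Ev (f i.1) _
    constructor
    · intro h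
      obtain ⟨J0, hJ0⟩ := hinv l
      refine eventually_atTop.2 ⟨J0, fun J hJ i => ?_⟩
      have h1 := (ih i.1 (hφ _) (hn i.1 i.2) l).1 (h i)
      obtain ⟨J', h2, h3⟩ := (h1.and (eventually_ge_atTop J0)).exists
      exact hJ0 _ (hφ _) J' h3 J hJ h2
    · intro h i
      exact (ih i.1 (hφ _) (hn i.1 i.2) l).2 (h.mono fun J hJ => hJ i)
  | all x φ ih =>
    intro hc hn l
    have hφ : φ ∈ P := hP _ hc (Or.inr (self_mem_subs φ))
    have ih' := ih hφ hn
    constructor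
    · intro h
      by_contra hcon
      have h1 := dich _ hc l hcon
      let t := skT (P := P) ⟨_, hc⟩ l 0
      have h2 : Ev φ (Function.update (fun k => cl m0 v (asg dT l k)) x (cl m0 v t)) := h _
      rw [upd_cl, ih'] at h2
      obtain ⟨J, hJ1, hJ2⟩ := (h1.and h2).exists
      rw [← upd_vl] at hJ2
      have h3 : ∃ a, ¬ Ev φ (Function.update (fun k => vl m0 v J (asg dT l k)) x a) := by
        by_contra h4
        push Not at h4
        exact hJ1 h4
      obtain ⟨a, ha⟩ := h3
      have h5 := Wit_spec m0 (.all x φ) (fun k => vl m0 v J (asg dT l k)) ⟨fun _ => a, ha⟩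
      simp only [WitOK] at h5
      apply h5
      have h6 := vl_skT m0 v J (⟨_, hc⟩ : P) l 0
      rw [← h6]
      exact hJ2
    · intro h a
      obtain ⟨t, rfl⟩ := cl_surj m0 v a
      change Ev φ (Function.update (fun k => cl m0 v (asg dT l k)) x (cl m0 v t))
      rw [upd_cl, ih']
      refine h.mono fun J hJ => ?_
      rw [← upd_vl]
      exact hJ _
  | wo x y φ ih =>
    intro hc hn l
    have hφ : φ ∈ P := hP _ hc (Or.inr (self_mem_subs φ))
    have ih' := ih hφ hn
    -- relation in the two models
    have key : ∀ t s : (LK P).Term I,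
        Ev φ (Function.update (Function.update (fun k => cl m0 v (asg dT l k)) x (cl m0 v t))
          y (cl m0 v s)) ↔ ∀ᶠ J in (atTop : Filter C),
        Ev φ (Function.update (Function.update (fun k => vl m0 v J (asg dT l k)) x (vl m0 v J t))
          y (vl m0 v J s)) := by
      intro t s
      simp only [upd_cl, upd_vl]
      exact ih' _
    have keyn : ∀ t s : (LK P).Term I,
        ¬ Ev φ (Function.update (Function.update (fun k => cl m0 v (asg dT l k)) x (cl m0 v t))
          y (cl m0 v s)) → ∀ᶠ J in (atTop : Filter C),
        ¬ Ev φ (Function.update (Function.update (fun k => vl m0 v J (asg dT l k)) x (vl m0 v J t))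
          y (vl m0 v J s)) := by
      intro t s h
      simp only [upd_cl, upd_vl] at h ⊢
      rw [ih'] at h
      exact dich _ hφ _ h
    constructor
    · intro h
      by_contra hcon
      have h1 := dich _ hc l hcon
      refine (not_wof_iff (fun a b => Ev φ (Function.update (Function.update
        (fun k => cl m0 v (asg dT l k)) x a) y b))).2
        ⟨fun j => cl m0 v (skT (P := P) ⟨_, hc⟩ l j), ?_⟩ h
      have h2 : ∀ᶠ J in (atTop : Filter C), BadSeq (fun a b => Ev φ (Function.update
          (Function.update (fun k => vl m0 v J (asg dT l k)) x a) y b))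
          (fun j => vl m0 v J (skT (P := P) ⟨_, hc⟩ l j)) := by
        refine h1.mono fun J hJ => ?_
        obtain ⟨w, hw⟩ := (not_wof_iff (fun a b => Ev φ (Function.update (Function.update
          (fun k => vl m0 v J (asg dT l k)) x a) y b))).1 hJ
        have h5 := Wit_spec m0 (.wo x y φ) (fun k => vl m0 v J (asg dT l k)) ⟨w, hw⟩
        simp only [vl_skT]
        exact h5
      by_contra hb
      unfold BadSeq at hb
      rw [not_or] at hb
      obtain ⟨hb1, hb2⟩ := hb
      rw [not_forall] at hb1
      obtain ⟨n, hb1⟩ := hb1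
      have e1 := keyn _ _ hb1
      apply hb2
      -- eventually the second alternative holds
      have h3 := (h2.and e1).mono fun J hJ => Or.resolve_left hJ.1 fun h => hJ.2 (h n)
      have or_lem : ∀ t s : (LK P).Term I, (∀ᶠ J in (atTop : Filter C),
          Ev φ (Function.update (Function.update (fun k => vl m0 v J (asg dT l k)) x (vl m0 v J t))
          y (vl m0 v J s)) ∨
          Ev φ (Function.update (Function.update (fun k => vl m0 v J (asg dT l k)) x (vl m0 v J s))
          y (vl m0 v J t))) →
          Ev φ (Function.update (Function.update (fun k => cl m0 v (asg dT l k)) x (cl m0 v t))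
          y (cl m0 v s)) ∨
          Ev φ (Function.update (Function.update (fun k => cl m0 v (asg dT l k)) x (cl m0 v s))
          y (cl m0 v t)) := by
        intro t s h
        by_contra hno
        rw [not_or] at hno
        obtain ⟨J, ⟨ha, hb⟩, hc⟩ := ((keyn _ _ hno.1).and (keyn _ _ hno.2)).and h |>.exists
        rcases hc with hc | hc
        exacts [ha hc, hb hc]
      refine ⟨or_lem _ _ (h3.mono fun J hJ => hJ.1), or_lem _ _ (h3.mono fun J hJ => hJ.2.1),
        ?_, ?_, ?_⟩
      · intro hE
        obtain ⟨J, ha, hb⟩ := (((key _ _).1 hE).and h3).exists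
        exact hb.2.2.1 ha
      · intro hE
        obtain ⟨J, ha, hb⟩ := (((key _ _).1 hE).and h3).exists
        exact hb.2.2.2.1 ha
      · intro hE
        obtain ⟨J, ha, hb⟩ := (((cl_eq m0 v).1 hE).and h3).exists
        exact hb.2.2.2.2 ha
    · intro h
      by_contra hcon
      obtain ⟨s, hs⟩ := (not_wof_iff (fun a b => Ev φ (Function.update (Function.update
        (fun k => cl m0 v (asg dT l k)) x a) y b))).1 hcon
      choose t ht using fun n => cl_surj m0 v (s n)
      obtain rfl : (fun n => cl m0 v (t n)) = s := funext ht
      have h2 : ∀ᶠ J in (atTop : Filter C), BadSeq (fun a b => Ev φ (Function.update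
          (Function.update (fun k => vl m0 v J (asg dT l k)) x a) y b))
          (fun j => vl m0 v J (t j)) := by
        rcases hs with hs | ⟨h0, h1, h2, h3, h4⟩
        · refine (cint _ fun n => (key _ _).1 (hs n)).mono fun J hJ => Or.inl hJ
        · have or_lem : ∀ t s : (LK P).Term I,
              (Ev φ (Function.update (Function.update (fun k => cl m0 v (asg dT l k)) x (cl m0 v t))
              y (cl m0 v s)) ∨
              Ev φ (Function.update (Function.update (fun k => cl m0 v (asg dT l k)) x (cl m0 v s))
              y (cl m0 v t))) → (∀ᶠ J in (atTop : Filter C),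
              Ev φ (Function.update (Function.update (fun k => vl m0 v J (asg dT l k)) x
                (vl m0 v J t)) y (vl m0 v J s)) ∨
              Ev φ (Function.update (Function.update (fun k => vl m0 v J (asg dT l k)) x
                (vl m0 v J s)) y (vl m0 v J t))) := by
            intro t s h
            rcases h with h | h
            · exact ((key _ _).1 h).mono fun _ => Or.inl
            · exact ((key _ _).1 h).mono fun _ => Or.inr
          have h5 : ∀ᶠ J in (atTop : Filter C), vl m0 v J (t 0) ≠ vl m0 v J (t 1) := by
            have := dich _ hE [(0, t 0), (1, t 1)]
            simp only [Ev, Code.dec, Eval, Language.Term.realize, asg, ne_eq, one_ne_zero,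
              not_false_eq_true, Function.update_self, Function.update_of_ne] at this
            exact this fun h => h4 ((cl_eq m0 v).2 h)
          filter_upwards [or_lem _ _ h0, or_lem _ _ h1, keyn _ _ h2, keyn _ _ h3, h5]
            with J a b c d e
          exact Or.inr ⟨a, b, c, d, e⟩
      obtain ⟨J, hJ, hJ'⟩ := (h.and h2).exists
      exact (not_wof_iff _).2 ⟨_, hJ'⟩ hJ
  | c X φ ih => intro _ hn; exact hn.elim

end Core
end Hanf
end PartPB

section PartPC
open FirstOrder Cardinal Filter
namespace Hanf
variable {Λ : Type}

/-- Order-theoretic form of the Baumgartner–Galvin property, with colors in `Set Λ`. -/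
def BGo (Λ D : Type) [LinearOrder D] : Prop :=
  ∀ f : Finset D → Set Λ, ∃ γ : ℕ → Set Λ,
    ∀ (J : Type) [LinearOrder J] [WellFoundedLT J] [Countable J],
      ∃ h : J ↪o D, ∀ u : Finset J, f (u.map h.toEmbedding) = γ u.card

theorem BGo.mono {D D' : Type} [LinearOrder D] [LinearOrder D'] (h : BGo Λ D) (e : D ↪o D') :
    BGo Λ D' := by
  intro f
  obtain ⟨γ, hγ⟩ := h (fun u => f (u.map e.toEmbedding))
  refine ⟨γ, ?_⟩
  intro J _ _ _
  obtain ⟨h, hh⟩ := hγ J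
  refine ⟨h.trans e, fun u => ?_⟩
  rw [← hh u, Finset.map_map]
  rfl

theorem BGo.embeds {D : Type} [LinearOrder D] (h : BGo Λ D)
    (J : Type) [LinearOrder J] [WellFoundedLT J] [Countable J] : Nonempty (J ↪o D) := by
  obtain ⟨γ, hγ⟩ := h (fun _ => ∅)
  exact ⟨(hγ J).choose⟩

theorem term_supp {K : FirstOrder.Language.{0,0}} {I : Type} (t : K.Term I) :
    ∃ u : Finset I, ∀ (M : Type) (S : K.Structure M) (v v' : I → M), (∀ i ∈ u, v i = v' i) →
      t.realize v = t.realize v' := by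
  classical
  induction t with
  | var i => exact ⟨{i}, fun M S v v' h => h i (by simp)⟩
  | func f ts ih =>
    choose u hu using ih
    refine ⟨Finset.univ.biUnion u, fun M S v v' h => ?_⟩
    simp only [Language.Term.realize]
    congr 1
    funext i
    exact hu i M S v v' fun k hk => h k (Finset.mem_biUnion.2 ⟨i, Finset.mem_univ _, hk⟩)

theorem list_supp {K : FirstOrder.Language.{0,0}} {I : Type} (l : List (ℕ × K.Term I)) :
    ∃ u : Finset I, ∀ (M : Type) (S : K.Structure M) (v v' : I → M), (∀ i ∈ u, v i = v' i) →
      ∀ q ∈ l, q.2.realize v = q.2.realize v' := by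
  classical
  induction l with
  | nil => exact ⟨∅, by simp⟩
  | cons q l ih =>
    obtain ⟨u, hu⟩ := ih
    obtain ⟨w, hw⟩ := term_supp q.2
    refine ⟨u ∪ w, fun M S v v' h q' hq' => ?_⟩
    rcases List.mem_cons.1 hq' with rfl | hq'
    · exact hw M S v v' fun i hi => h i (Finset.mem_union_right _ hi)
    · exact hu M S v v' (fun i hi => h i (Finset.mem_union_left _ hi)) q' hq'

section Rank
variable {D M I : Type} [LinearOrder D] [LinearOrder I]

/-- Number of elements of `u` below `i`. -/
def rk (u : Finset I) (i : I) : ℕ := (u.filter (· < i)).card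

theorem rk_lt {u : Finset I} {i j : I} (hi : i ∈ u) (hij : i < j) : rk u i < rk u j := by
  refine Finset.card_lt_card ⟨?_, ?_⟩
  · intro k hk
    simp only [Finset.mem_filter] at hk ⊢
    exact ⟨hk.1, hk.2.trans hij⟩
  · intro h
    have := h (Finset.mem_filter.2 ⟨hi, hij⟩)
    simp at this

theorem rk_inj {u : Finset I} {i j : I} (hi : i ∈ u) (hj : j ∈ u) (h : rk u i = rk u j) :
    i = j := by
  rcases lt_trichotomy i j with h' | h' | h'
  · exact absurd h (rk_lt hi h').ne
  · exact h'
  · exact absurd h (rk_lt hj h').ne'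

open Classical in
/-- The `k`-th element of `w`. -/
noncomputable def nth (m0 : M) (e : D → M) (w : Finset D) (k : ℕ) : M :=
  if h : ∃ a ∈ w, rk w a = k then e h.choose else m0

theorem nth_rk (m0 : M) (e : D → M) {w : Finset D} {a : D} (ha : a ∈ w) :
    nth m0 e w (rk w a) = e a := by
  have h : ∃ b ∈ w, rk w b = rk w a := ⟨a, ha, rfl⟩
  unfold nth
  rw [dif_pos h, rk_inj h.choose_spec.1 ha h.choose_spec.2]

theorem rk_image [DecidableEq D] (u : Finset I) (σ : I → D) (hσ : StrictMonoOn σ (u : Set I))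
    {i : I} (hi : i ∈ u) : rk (u.image σ) (σ i) = rk u i := by
  unfold rk
  have : (u.image σ).filter (· < σ i) = (u.filter (· < i)).image σ := by
    ext d
    simp only [Finset.mem_filter, Finset.mem_image]
    constructor
    · rintro ⟨⟨k, hk, rfl⟩, h⟩
      exact ⟨k, ⟨hk, (hσ.lt_iff_lt hk hi).1 h⟩, rfl⟩
    · rintro ⟨k, ⟨hk, h⟩, rfl⟩
      exact ⟨⟨k, hk, rfl⟩, (hσ.lt_iff_lt hk hi).2 h⟩
  rw [this, Finset.card_image_of_injOn]
  exact hσ.injOn.mono (by intro k hk; exact (Finset.mem_filter.1 hk).1)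

end Rank

theorem card_colors {lam : Cardinal.{0}} (hl : ℵ₀ ≤ lam) (hΛ : #Λ = lam) (P : Set (Code Λ))
    (hP : #P ≤ lam) : #(P × List (ℕ × (LK P).Term ℕ)) ≤ lam := by
  have hK : #(Σ n, (LK P).Functions n) ≤ lam := by
    rw [mk_sigma]
    refine (Cardinal.sum_le_sum _ (fun _ => lam) fun n => ?_).trans ?_
    · change #(Option (Λ ⊕ (P × (Fin n → ℕ) × ℕ))) ≤ lam
      rw [mk_option, mk_sum, mk_prod, mk_prod]
      simp only [lift_id]
      refine add_le_of_le hl (add_le_of_le hl hΛ.le ?_) (one_le_aleph0.trans hl)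
      refine mul_le_of_le hl hP (mul_le_of_le hl ?_ ?_)
      · exact (Cardinal.mk_le_aleph0).trans hl
      · exact (Cardinal.mk_le_aleph0).trans hl
    · rw [Cardinal.sum_const']
      exact mul_le_of_le hl (mk_le_aleph0.trans hl) le_rfl
  have hT : #((LK P).Term ℕ) ≤ lam := by
    refine Language.Term.card_le.trans (max_le hl ?_)
    rw [mk_sum]
    simp only [lift_id]
    exact add_le_of_le hl (mk_le_aleph0.trans hl) hK
  rw [mk_prod]
  simp only [lift_id]
  refine mul_le_of_le hl hP ((mk_list_le_max _).trans (max_le hl ?_))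
  rw [mk_prod]
  simp only [lift_id]
  exact mul_le_of_le hl (mk_le_aleph0.trans hl) hT

/-- Upward transfer for codes. -/
theorem em_exists {lam : Cardinal.{0}} (hl : ℵ₀ ≤ lam) (hΛ : #Λ = lam) {D : Type} [LinearOrder D]
    (hBG : BGo Λ D) {M : Type} [(LS Λ).Structure M] (e : D ↪ M) (c : Code Λ) (hc : NoSet c)
    (hM : ∀ va : ℕ → M, Ev c va) (κ : Cardinal.{0}) :
    ∃ (N : Type) (S : (LS Λ).Structure N), κ ≤ #N ∧ ∃ va : ℕ → N, Ev c va := by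
  classical
  obtain ⟨h0⟩ := hBG.embeds ℕ
  let d0 : D := h0 0
  let m0 : M := e d0
  let P : Set (Code Λ) := insert (Code.eq (.var 0) (.var 1)) (subs c)
  have hPc : #P ≤ lam := mk_insert_le_of hl (subs_card hl hΛ c)
  let X := P × List (ℕ × (LK P).Term ℕ)
  obtain ⟨jX⟩ : Nonempty (X ↪ Λ) :=
    Cardinal.le_def _ _ |>.1 ((card_colors hl hΛ P hPc).trans hΛ.ge)
  let f : Finset D → Set Λ := fun w => jX '' {x | Ev x.1.1 (fun k =>
    vl m0 (nth m0 e) w (asg dT x.2 k))}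
  obtain ⟨γ, hγ⟩ := hBG f
  let I := κ.ord.ToType
  let C := {J : Set I // J.Countable}
  have hh : ∀ J : C, ∃ h : J.1 ↪o D, ∀ u : Finset J.1, f (u.map h.toEmbedding) = γ u.card := by
    intro J
    have : Countable J.1 := J.2
    exact hγ J.1
  choose h hh using hh
  let sg : C → I → D := fun J i => if hi : i ∈ J.1 then h J ⟨i, hi⟩ else d0
  have sgmono : ∀ J : C, StrictMonoOn (sg J) J.1 := by
    intro J a ha b hb hab
    simp only [sg, dif_pos ha, dif_pos hb]
    exact (h J).strictMono hab
  have sgcol : ∀ (J : C) (u : Finset I), (u : Set I) ⊆ J.1 → f (u.image (sg J)) = γ u.card := by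
    intro J u hu
    have e1 : u.image (sg J) = (u.subtype (· ∈ J.1)).map (h J).toEmbedding := by
      ext d
      simp only [Finset.mem_image, Finset.mem_map, Finset.mem_subtype, Subtype.exists]
      constructor
      · rintro ⟨i, hi, rfl⟩
        refine ⟨i, hu hi, hi, ?_⟩
        simp only [sg, dif_pos (show i ∈ J.1 from hu hi)]
        rfl
      · rintro ⟨i, hi, hi', rfl⟩
        refine ⟨i, hi', ?_⟩
        simp only [sg, dif_pos hi]
        rfl
    rw [e1, hh, Finset.card_subtype, Finset.filter_true_of_mem]
    exact fun i hi => hu hi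
  let v : C → I → M := fun J i => e (sg J i)
  have : Nonempty C := ⟨⟨∅, Set.countable_empty⟩⟩
  have : IsDirectedOrder C := ⟨fun a b => ⟨⟨a.1 ∪ b.1, a.2.union b.2⟩,
    Set.subset_union_left, Set.subset_union_right⟩⟩
  have hcount : ∀ s : ℕ → C, ∃ J, ∀ n, s n ≤ J := fun s =>
    ⟨⟨⋃ n, (s n).1, Set.countable_iUnion fun n => (s n).2⟩, fun n =>
      Set.subset_iUnion (fun n => (s n).1) n⟩
  have hP : ∀ d ∈ P, subs d ⊆ P := by
    rintro d (rfl | hd)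
    · intro x hx
      simp only [subs, Set.mem_singleton_iff] at hx
      exact Or.inl hx
    · exact (subs_subset c d hd).trans (Set.subset_insert _ _)
  have hinv : ∀ l : List (ℕ × (LK P).Term I), ∃ J0 : C, ∀ c ∈ P, ∀ J ≥ J0, ∀ J' ≥ J0,
      Ev c (fun k => vl m0 v J (asg dT l k)) → Ev c (fun k => vl m0 v J' (asg dT l k)) := by
    intro l
    obtain ⟨u, hu⟩ := list_supp l
    let l0 : List (ℕ × (LK P).Term ℕ) := l.map fun q => (q.1, q.2.relabel (rk u))
    have key : ∀ J : C, (u : Set I) ⊆ J.1 → (fun k => vl m0 v J (asg dT l k)) =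
        fun k => vl m0 (nth m0 e) (u.image (sg J)) (asg dT l0 k) := by
      intro J hJ
      rw [asg_map (vl m0 v J), asg_map (vl m0 (nth m0 e) (u.image (sg J))), vl_dT, vl_dT,
        List.map_map]
      congr 1
      refine List.map_congr_left fun q hq => ?_
      simp only [Function.comp_apply, Prod.mk.injEq, true_and]
      unfold vl
      letI := KS P m0
      rw [Language.Term.realize_relabel]
      refine hu M _ _ _ ?_ q hq
      intro i hi
      have hm : StrictMonoOn (sg J) (u : Set I) := (sgmono J).mono hJ
      simp only [Function.comp_apply, v]
      rw [← rk_image u (sg J) hm hi, nth_rk]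
      exact Finset.mem_image_of_mem _ hi
    have key2 : ∀ J : C, (u : Set I) ⊆ J.1 → ∀ d (hd : d ∈ P),
        (Ev d (fun k => vl m0 v J (asg dT l k)) ↔ jX (⟨d, hd⟩, l0) ∈ γ u.card) := by
      intro J hJ d hd
      rw [key J hJ, ← sgcol J u hJ]
      simp only [f]
      rw [jX.injective.mem_set_image]
      rfl
    refine ⟨⟨(u : Set I), u.countable_toSet⟩, fun d hd J hJ J' hJ' hE => ?_⟩
    exact (key2 J' hJ' d hd).2 ((key2 J hJ d hd).1 hE)
  refine ⟨EM m0 v P, inferInstance, ?_, fun k => cl m0 v (asg dT [] k), ?_⟩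
  · have hI : #I = κ := by simp [I]
    rw [← hI]
    refine mk_le_of_injective (f := fun i : I => cl m0 v (Language.Term.var i : (LK P).Term I)) ?_
    intro i j hij
    have := (cl_eq m0 v).1 hij
    have h2 : ∀ᶠ J in (atTop : Filter C), (⟨{i, j}, by simp⟩ : C) ≤ J := eventually_ge_atTop _
    obtain ⟨J, hJ, hJ'⟩ := (this.and h2).exists
    have e1 : sg J i = sg J j := e.injective hJ
    exact (sgmono J).injOn (hJ' (by simp)) (hJ' (by simp)) e1
  · refine (em_truth m0 v hcount hP (Or.inl rfl) hinv c (Or.inr (self_mem_subs c)) hc []).2 ?_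
    exact Eventually.of_forall fun J => hM _

/-- Models of size at least `|D|` of a sentence with bounded spectrum do not exist. -/
theorem wo_bound {lam : Cardinal.{0}} (hl : ℵ₀ ≤ lam) (hΛ : #Λ = lam) {D : Type} [LinearOrder D]
    (hBG : BGo Λ D) : hanfNum (LwoInf (Order.succ lam)) ≤ #D := by
  have hne : Nonempty Λ := by
    rw [← Cardinal.mk_ne_zero_iff, hΛ]
    exact (aleph0_pos.trans_le hl).ne'
  refine csSup_le' ?_
  rintro _ ⟨L, φ, hs, hok, ⟨κ, hκ⟩, rfl⟩
  refine csSup_le' ?_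
  rintro _ ⟨M, S, hS, rfl⟩
  refine Order.succ_le_of_lt ?_
  by_contra hlt
  rw [not_lt] at hlt
  obtain ⟨e⟩ : Nonempty (D ↪ M) := Cardinal.le_def _ _ |>.1 hlt
  obtain ⟨h0⟩ := hBG.embeds ℕ
  have : Nonempty M := ⟨e (h0 0)⟩
  obtain ⟨c, hc, h1, h2⟩ := code_spec (Λ := Λ) hl hΛ (A := LwoInf (Order.succ lam))
    (fun h => h) (fun h => h) (fun h => h) rfl φ hok
  obtain ⟨S', hS'⟩ := h2 M S
  obtain ⟨N, T, hN, va, hva⟩ := em_exists hl hΛ hBG e c (hc (fun h => h) hs.2.1 hs.2.2)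
    (fun va => (hS' _ _ _).2 (hS _ _ _)) κ
  obtain ⟨T', hT'⟩ := h1 N T
  have := hκ N T' (sat_of_eval hs ((hT' _ _ _).1 hva))
  exact absurd hN (not_le.2 this)

end Hanf
end PartPC

section PartPD
open FirstOrder Cardinal
namespace Hanf

section Syn
variable {L : FirstOrder.Language.{0,0}}

def fAnd (φ ψ : Fml L) : Fml L := .conj Bool (fun b => cond b φ ψ)
def fImp (φ ψ : Fml L) : Fml L := .not (fAnd φ (.not ψ))
def fIff (φ ψ : Fml L) : Fml L := fAnd (fImp φ ψ) (fImp ψ φ)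
def fEx (x : ℕ) (φ : Fml L) : Fml L := .not (.all x (.not φ))
def fAllC (X : ℕ) (φ : Fml L) : Fml L := .not (.qC X (.not φ))

/-- Quantify over the variables `10, …, n + 9`. -/
def alls : ℕ → Fml L → Fml L
  | 0, φ => φ
  | n + 1, φ => alls n (.all (n + 10) φ)

section
variable {M : Type} [L.Structure M] (va : ℕ → M) (vs : ℕ → Set M) (vr : ℕ → M → M → Prop)

theorem eval_and (φ ψ : Fml L) : Eval (fAnd φ ψ) va vs vr ↔ Eval φ va vs vr ∧ Eval ψ va vs vr := by
  simp [fAnd, Eval, and_comm]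

theorem eval_imp (φ ψ : Fml L) : Eval (fImp φ ψ) va vs vr ↔ (Eval φ va vs vr → Eval ψ va vs vr) := by
  simp [fImp, Eval, eval_and]

theorem eval_iff (φ ψ : Fml L) : Eval (fIff φ ψ) va vs vr ↔ (Eval φ va vs vr ↔ Eval ψ va vs vr) := by
  simp [fIff, eval_imp, eval_and, iff_def]

theorem eval_ex (x : ℕ) (φ : Fml L) :
    Eval (fEx x φ) va vs vr ↔ ∃ a, Eval φ (Function.update va x a) vs vr := by
  simp [fEx, Eval]

theorem eval_allC (X : ℕ) (φ : Fml L) :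
    Eval (fAllC X φ) va vs vr ↔
      ∀ S : Set M, S.Countable → Eval φ va (Function.update vs X S) vr := by
  simp [fAllC, Eval]

theorem eval_alls (n : ℕ) : ∀ (φ : Fml L), Eval (alls n φ) va vs vr ↔
    ∀ va' : ℕ → M, (∀ k, k < 10 ∨ n + 10 ≤ k → va' k = va k) → Eval φ va' vs vr := by
  induction n with
  | zero =>
    intro φ
    constructor
    · intro h va' h'
      have : va' = va := funext fun k => h' k (by omega)
      rw [this]; exact h
    · intro h
      exact h va (fun _ _ => rfl)
  | succ n ih =>
    intro φ
    simp only [alls]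
    rw [ih]
    constructor
    · intro h va' h'
      have := h (Function.update va' (n + 10) (va (n + 10))) (by
        intro k hk
        by_cases hkn : k = n + 10
        · subst hkn; simp
        · rw [Function.update_of_ne hkn]
          exact h' k (by omega))
      simp only [Eval] at this
      have h2 := this (va' (n + 10))
      simpa using h2
    · intro h va' h' a
      refine h _ fun k hk => ?_
      rw [Function.update_of_ne (by omega)]
      exact h' k (by omega)
end

theorem fv_and (φ ψ : Fml L) : fv (fAnd φ ψ) = fv φ ∪ fv ψ := by
  ext k; simp [fAnd, fv, or_comm]
theorem sv_and (φ ψ : Fml L) : sv (fAnd φ ψ) = sv φ ∪ sv ψ := by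
  ext k; simp [fAnd, sv, or_comm]
theorem rv_and (φ ψ : Fml L) : rv (fAnd φ ψ) = rv φ ∪ rv ψ := by
  ext k; simp [fAnd, rv, or_comm]
theorem fv_alls (n : ℕ) : ∀ φ : Fml L, fv (alls n φ) = fv φ \ {k | 10 ≤ k ∧ k < n + 10} := by
  induction n with
  | zero =>
    intro φ; ext k
    simp only [alls, Set.mem_sdiff, Set.mem_ofPred_eq]
    exact ⟨fun h => ⟨h, by omega⟩, fun h => h.1⟩
  | succ n ih =>
    intro φ
    simp only [alls]
    rw [ih]
    ext k
    simp only [fv, Set.mem_sdiff, Set.mem_ofPred_eq, Set.mem_singleton_iff, and_assoc]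
    refine and_congr_right fun _ => ?_
    omega
theorem sv_alls (n : ℕ) : ∀ φ : Fml L, sv (alls n φ) = sv φ := by
  induction n with
  | zero => intro φ; rfl
  | succ n ih => intro φ; simp only [alls]; rw [ih]; rfl
theorem rv_alls (n : ℕ) : ∀ φ : Fml L, rv (alls n φ) = rv φ := by
  induction n with
  | zero => intro φ; rfl
  | succ n ih => intro φ; simp only [alls]; rw [ih]; rfl
theorem ok_alls (A : Allowed) (n : ℕ) : ∀ φ : Fml L, Ok A (alls n φ) ↔ Ok A φ := by
  induction n with
  | zero => intro φ; rfl
  | succ n ih => intro φ; simp only [alls]; rw [ih]; rfl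
theorem ok_and (A : Allowed) (hA : ℵ₀ < A.conjBound) (φ ψ : Fml L) :
    Ok A (fAnd φ ψ) ↔ Ok A φ ∧ Ok A ψ := by
  have : (2 : Cardinal) < A.conjBound := lt_trans (by exact_mod_cast natCast_lt_aleph0 (n := 2)) hA
  simp [fAnd, Ok, and_comm, this]
end Syn

/-- The vocabulary of the `L^c` sentence. -/
def LV (Λ : Type) : FirstOrder.Language.{0,0} where
  Functions := fun n => match n with
    | 2 => Unit
    | _ => Empty
  Relations := fun _ => Λ ⊕ Unit

variable {Λ : Type}

def pS : (LV Λ).Functions 2 := ()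
def ltS : (LV Λ).Relations 2 := Sum.inr ()
def colS (i : Λ) (n : ℕ) : (LV Λ).Relations (n + 1) := Sum.inl i

def vt (k : ℕ) : (LV Λ).Term ℕ := .var k
def pT (x y : ℕ) : (LV Λ).Term ℕ := .func pS ![vt x, vt y]
def fLt (x y : ℕ) : Fml (LV Λ) := .rel ltS ![vt x, vt y]
def fMem (X x : ℕ) : Fml (LV Λ) := .mem X (vt x)
def fPM (X x y : ℕ) : Fml (LV Λ) := .mem X (pT x y)
/-- `R_i(v_0, v_{c}, v_{c+2}, …)`. -/
def fCol (i : Λ) (n c : ℕ) : Fml (LV Λ) :=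
  .rel (colS i n) (Fin.cons (vt 0) (fun k : Fin n => vt (c + 2 * k.1)))

section
variable {M : Type} [(LV Λ).Structure M]
def mLt (Λ : Type) {M : Type} [(LV Λ).Structure M] (x y : M) : Prop :=
  Language.Structure.RelMap (ltS (Λ := Λ)) ![x, y]
def mP (Λ : Type) {M : Type} [(LV Λ).Structure M] (x y : M) : M :=
  Language.Structure.funMap (pS (Λ := Λ)) ![x, y]
def mCol (i : Λ) {n : ℕ} (a : M) (x : Fin n → M) : Prop :=
  Language.Structure.RelMap (colS i n) (Fin.cons a x : Fin (n + 1) → M)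

variable (va : ℕ → M) (vs : ℕ → Set M) (vr : ℕ → M → M → Prop)
theorem eval_lt (x y : ℕ) : Eval (fLt (Λ := Λ) x y) va vs vr ↔ mLt Λ (va x) (va y) := by
  simp only [fLt, Eval, mLt]
  have : (fun i => ((![vt x, vt y] : Fin 2 → (LV Λ).Term ℕ) i).realize va) = ![va x, va y] := by
    funext i; fin_cases i <;> rfl
  rw [this]
theorem real_pT (x y : ℕ) : (pT (Λ := Λ) x y).realize va = mP Λ (va x) (va y) := by
  simp only [pT, Language.Term.realize, mP]
  have : (fun i => ((![vt x, vt y] : Fin 2 → (LV Λ).Term ℕ) i).realize va) = ![va x, va y] := by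
    funext i; fin_cases i <;> rfl
  rw [this]
theorem eval_mem (X x : ℕ) : Eval (fMem (Λ := Λ) X x) va vs vr ↔ va x ∈ vs X := Iff.rfl
theorem eval_pm (X x y : ℕ) : Eval (fPM (Λ := Λ) X x y) va vs vr ↔ mP Λ (va x) (va y) ∈ vs X := by
  simp only [fPM, Eval, real_pT]
theorem eval_col (i : Λ) (n c : ℕ) : Eval (fCol i n c) va vs vr ↔
    mCol i (va 0) (fun k : Fin n => va (c + 2 * k.1)) := by
  simp only [fCol, Eval, mCol]
  have : (fun j => ((Fin.cons (vt 0) (fun k : Fin n => vt (c + 2 * k.1)) :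
      Fin (n + 1) → (LV Λ).Term ℕ) j).realize va) =
      Fin.cons (va 0) (fun k : Fin n => va (c + 2 * k.1)) := by
    funext j
    refine Fin.cases rfl (fun k => rfl) j
  rw [this]
end

/-- `v_c < v_{c+2} < …`, all in `X`. -/
def fInc (X n c : ℕ) : Fml (LV Λ) :=
  fAnd (.conj (Fin n) fun k => fMem X (c + 2 * k.1))
    (.conj {q : Fin n × Fin n // q.1 < q.2} fun q => fLt (c + 2 * q.1.1.1) (c + 2 * q.1.2.1))

def fSim (X Y : ℕ) : Fml (LV Λ) :=
  .conj (ℕ × Λ) fun q => alls (2 * q.1) (fImp (fAnd (fInc X q.1 10) (fInc Y q.1 11))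
    (fIff (fCol q.2 q.1 10) (fCol q.2 q.1 11)))

section
variable {M : Type} [(LV Λ).Structure M]

/-- Increasing tuple from `X`. -/
def mInc (Λ : Type) {M : Type} [(LV Λ).Structure M] (X : Set M) {n : ℕ} (x : Fin n → M) : Prop :=
  (∀ k, x k ∈ X) ∧ ∀ k l, k < l → mLt Λ (x k) (x l)

def mSim (Λ : Type) {M : Type} [(LV Λ).Structure M] (a : M) (X Y : Set M) : Prop :=
  ∀ (n : ℕ) (i : Λ) (x y : Fin n → M), mInc Λ X x → mInc Λ Y y → (mCol i a x ↔ mCol i a y)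

variable (va : ℕ → M) (vs : ℕ → Set M) (vr : ℕ → M → M → Prop)

theorem eval_inc (X n c : ℕ) : Eval (fInc (Λ := Λ) X n c) va vs vr ↔
    mInc Λ (vs X) (fun k : Fin n => va (c + 2 * k.1)) := by
  simp only [fInc, eval_and, Eval, eval_mem, eval_lt, mInc, Subtype.forall, Prod.forall]

theorem eval_sim (X Y : ℕ) : Eval (fSim (Λ := Λ) X Y) va vs vr ↔
    mSim Λ (va 0) (vs X) (vs Y) := by
  simp only [fSim, Eval, eval_alls, eval_imp, eval_iff, eval_and, eval_inc, eval_col, mSim,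
    Prod.forall]
  refine forall_congr' fun n => forall_congr' fun i => ?_
  constructor
  · intro h x y hx hy
    let va' : ℕ → M := fun k => if h : k < 10 ∨ 2 * n + 10 ≤ k then va k else
      if k % 2 = 0 then x ⟨(k - 10) / 2, by omega⟩ else y ⟨(k - 10) / 2, by omega⟩
    have h10 : ∀ k : Fin n, va' (10 + 2 * k.1) = x k := by
      intro k
      have := k.2
      simp only [va']
      rw [dif_neg (by omega), if_pos (by omega)]
      congr 1; ext; simp
    have h11 : ∀ k : Fin n, va' (11 + 2 * k.1) = y k := by
      intro k
      have := k.2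
      simp only [va']
      rw [dif_neg (by omega), if_neg (by omega)]
      congr 1; ext; simp; omega
    have h0 : va' 0 = va 0 := by simp [va']
    have := h va' (fun k hk => by simp only [va']; rw [dif_pos hk])
    simp only [h10, h11, h0] at this
    exact this ⟨hx, hy⟩
  · intro h va' h' hh
    have := h _ _ hh.1 hh.2
    rw [h' 0 (by omega)]
    exact this
end

def fA1 : Fml (LV Λ) := fAnd (.all 0 (.not (fLt 0 0)))
  (fAnd (.all 0 (.all 1 (.all 2 (fImp (fAnd (fLt 0 1) (fLt 1 2)) (fLt 0 2)))))
    (.all 0 (.all 1 (fImp (.not (fLt 0 1)) (fImp (.not (fLt 1 0)) (.eq (vt 0) (vt 1)))))))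

def fA2 : Fml (LV Λ) := fAllC 4 (fImp (fEx 0 (fMem 4 0))
  (fEx 0 (fAnd (fMem 4 0) (.all 1 (fImp (fMem 4 1) (.not (fLt 1 0)))))))

def fA3 : Fml (LV Λ) := .all 0 (.all 1 (.all 2 (.all 3 (fImp (.eq (pT 0 1) (pT 2 3))
  (fAnd (.eq (vt 0) (vt 2)) (.eq (vt 1) (vt 3)))))))

def fH0 : Fml (LV Λ) := fAnd (.all 2 (fImp (fMem 0 2) (fLt 2 0))) (fAnd (fEx 2 (fMem 0 2))
  (fAnd (.all 2 (fImp (fMem 0 2) (fEx 3 (fAnd (fMem 0 3) (fLt 2 3))))) (fSim 0 0)))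

def fH1 : Fml (LV Λ) := fAnd (.all 2 (fImp (fMem 1 2) (fLt 2 0))) (fAnd (fSim 1 0)
  (fAnd (.all 2 (fImp (fLt 2 1) (fEx 3 (fAnd (fMem 1 3) (fPM 2 2 3)))))
    (.all 2 (.all 4 (.all 3 (.all 5 (fImp (fAnd (fAnd (fLt 2 4) (fLt 4 1))
      (fAnd (fPM 2 2 3) (fPM 2 4 5))) (fLt 3 5))))))))

def fA4 : Fml (LV Λ) := .all 0 (fAllC 0 (fImp fH0 (fEx 1 (fAnd
  (.qC 3 (.all 2 (fImp (fLt 2 1) (fMem 3 2)))) (fAllC 1 (fAllC 2 (.not fH1)))))))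

/-- The `L^c` sentence. -/
def fPsi : Fml (LV Λ) := fAnd fA1 (fAnd fA2 (fAnd fA3 fA4))

section
variable {M : Type} [(LV Λ).Structure M]

def mH0 (Λ : Type) {M : Type} [(LV Λ).Structure M] (a : M) (Y0 : Set M) : Prop :=
  (∀ x ∈ Y0, mLt Λ x a) ∧ (∃ x, x ∈ Y0) ∧ (∀ x ∈ Y0, ∃ y, y ∈ Y0 ∧ mLt Λ x y) ∧ mSim Λ a Y0 Y0

def mH1 (Λ : Type) {M : Type} [(LV Λ).Structure M] (a b : M) (Y0 Y Z : Set M) : Prop :=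
  (∀ x ∈ Y, mLt Λ x a) ∧ mSim Λ a Y Y0 ∧ (∀ x, mLt Λ x b → ∃ y, y ∈ Y ∧ mP Λ x y ∈ Z) ∧
    (∀ x x' y y', (mLt Λ x x' ∧ mLt Λ x' b) ∧ mP Λ x y ∈ Z ∧ mP Λ x' y' ∈ Z → mLt Λ y y')

structure Good (Λ : Type) (M : Type) [(LV Λ).Structure M] : Prop where
  irr : ∀ x : M, ¬ mLt Λ x x
  tr : ∀ x y z : M, mLt Λ x y → mLt Λ y z → mLt Λ x z
  tri : ∀ x y : M, ¬ mLt Λ x y → ¬ mLt Λ y x → x = y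
  wf : ∀ S : Set M, S.Countable → (∃ x, x ∈ S) → ∃ x, x ∈ S ∧ ∀ y ∈ S, ¬ mLt Λ y x
  inj : ∀ x y x' y' : M, mP Λ x y = mP Λ x' y' → x = x' ∧ y = y'
  main : ∀ (a : M) (Y0 : Set M), Y0.Countable → mH0 Λ a Y0 → ∃ b : M,
    (∃ B : Set M, B.Countable ∧ ∀ x, mLt Λ x b → x ∈ B) ∧
    ∀ Y : Set M, Y.Countable → ∀ Z : Set M, Z.Countable → ¬ mH1 Λ a b Y0 Y Z

theorem eval_psi (va : ℕ → M) (vs : ℕ → Set M) (vr : ℕ → M → M → Prop) :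
    Eval (fPsi (Λ := Λ)) va vs vr ↔ Good Λ M := by
  have e : ∀ k (va : ℕ → M), (vt (Λ := Λ) k).realize va = va k := fun _ _ => rfl
  simp only [fPsi, fA1, fA2, fA3, fA4, fH0, fH1, eval_and, eval_imp, eval_ex, eval_allC, Eval,
    eval_lt, eval_mem, eval_pm, eval_sim, real_pT, e]
  simp (decide := true) only [Function.update_self, Function.update_of_ne, ne_eq]
  constructor
  · rintro ⟨⟨h1, h2, h3⟩, h4, h5, h6⟩
    refine ⟨h1, fun x y z h h' => h2 x y z ⟨h, h'⟩, h3, h4, h5, fun a Y0 hY h => ?_⟩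
    exact h6 a Y0 hY h
  · intro h
    refine ⟨⟨h.irr, fun x y z h' => h.tr x y z h'.1 h'.2, h.tri⟩, h.wf, h.inj, ?_⟩
    intro a Y0 hY h'
    exact h.main a Y0 hY h'
end

theorem sent_psi : IsSentence (fPsi (Λ := Λ)) := by
  have t1 : ∀ k, tvars (vt (Λ := Λ) k) = {k} := fun _ => rfl
  have t2 : ∀ x y, tvars (pT (Λ := Λ) x y) = {x, y} := by
    intro x y; ext k; simp [pT, tvars, t1, Fin.exists_fin_two]
  have f1 : ∀ x y, fv (fLt (Λ := Λ) x y) = {x, y} := by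
    intro x y; ext k; simp [fLt, fv, t1, Fin.exists_fin_two]
  have f2 : ∀ X Y, fv (fSim (Λ := Λ) X Y) ⊆ {0} := by
    intro X Y k
    simp only [fSim, fv, fv_alls, fImp, fIff, fv_and, fInc, fMem, f1, fCol, t1]
    simp only [Set.mem_iUnion, Set.mem_sdiff, Set.mem_union, Set.mem_ofPred_eq, Fin.exists_fin_succ,
      Fin.cons_zero, Fin.cons_succ, t1, Set.mem_singleton_iff, Set.mem_insert_iff]
    rintro ⟨⟨n, i⟩, h, h'⟩
    by_contra hk
    apply h'
    have aux : ∀ j : Fin n, j.1 < n := fun j => j.2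
    rcases h with ((⟨j, h⟩ | ⟨q, h⟩) | (⟨j, h⟩ | ⟨q, h⟩)) | (((h | ⟨j, h⟩) | (h | ⟨j, h⟩)) | ((h | ⟨j, h⟩) | (h | ⟨j, h⟩)))
    all_goals first
      | exact absurd h hk
      | (have := aux j; dsimp only at *; omega)
      | (have := aux q.1.1; have := aux q.1.2; dsimp only at *; omega)
  have s2 : ∀ X Y, sv (fSim (Λ := Λ) X Y) ⊆ {X, Y} := by
    intro X Y k
    simp only [fSim, sv, sv_alls, fImp, fIff, sv_and, fInc, fMem, fLt, fCol]
    simp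
    rintro _ _ (h | h) <;> simp [h]
  have r2 : ∀ X Y, rv (fSim (Λ := Λ) X Y) = ∅ := by
    intro X Y
    simp [fSim, rv, rv_alls, fImp, fIff, rv_and, fInc, fMem, fLt, fCol]
  refine ⟨?_, ?_, ?_⟩
  · apply Set.eq_empty_of_subset_empty
    intro k
    have h0 := @f2 0 0 k
    have h1 := @f2 1 0 k
    simp only [fPsi, fA1, fA2, fA3, fA4, fH0, fH1, fv, fv_and, fImp, fEx, fAllC, f1, fMem, fPM, t1, t2]
    simp only [Set.mem_union, Set.mem_sdiff, Set.mem_singleton_iff, Set.mem_insert_iff,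
      Set.mem_empty_iff_false] at h0 h1 ⊢
    generalize (k ∈ fv (fSim (Λ := Λ) 0 0)) = p at *
    generalize (k ∈ fv (fSim (Λ := Λ) 1 0)) = q at *
    by_cases hp : p <;> by_cases hq : q <;>
      simp only [hp, hq, true_or, or_true, false_or, or_false, true_and, and_true, forall_const,
        false_implies] at h0 h1 ⊢ <;> omega
  · apply Set.eq_empty_of_subset_empty
    intro k
    have h0 := @s2 0 0 k
    have h1 := @s2 1 0 k
    simp only [fPsi, fA1, fA2, fA3, fA4, fH0, fH1, sv, sv_and, fImp, fEx, fAllC, fLt, fMem, fPM]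
    simp only [Set.mem_union, Set.mem_sdiff, Set.mem_singleton_iff, Set.mem_insert_iff,
      Set.mem_empty_iff_false] at h0 h1 ⊢
    generalize (k ∈ sv (fSim (Λ := Λ) 0 0)) = p at *
    generalize (k ∈ sv (fSim (Λ := Λ) 1 0)) = q at *
    by_cases hp : p <;> by_cases hq : q <;>
      simp only [hp, hq, true_or, or_true, false_or, or_false, true_and, and_true, forall_const,
        false_implies] at h0 h1 ⊢ <;> omega
  · simp [fPsi, fA1, fA2, fA3, fA4, fH0, fH1, rv, rv_and, fImp, fEx, fAllC, fLt, fMem, fPM, r2]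

theorem ok_psi {lam : Cardinal.{0}} (hl : ℵ₀ ≤ lam) (hΛ : #Λ = lam) :
    Ok (LcInf (Order.succ lam)) (fPsi (Λ := Λ)) := by
  have h : ℵ₀ < (LcInf (Order.succ lam)).conjBound := lt_of_le_of_lt hl (Order.lt_succ lam)
  have a := fun φ ψ => ok_and (L := LV Λ) _ h φ ψ
  have h1 : ∀ n : ℕ, #(Fin n) < (LcInf (Order.succ lam)).conjBound := fun n =>
    (lt_aleph0_of_finite _).trans h
  have h2 : ∀ n : ℕ, #{q : Fin n × Fin n // q.1 < q.2} < (LcInf (Order.succ lam)).conjBound :=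
    fun n => (lt_aleph0_of_finite _).trans h
  have h3 : #(ℕ × Λ) < (LcInf (Order.succ lam)).conjBound := by
    refine lt_of_le_of_lt ?_ (Order.lt_succ lam)
    rw [mk_prod, hΛ]
    simp [hl]
  have hc : (LcInf (Order.succ lam)).c := trivial
  simp only [fPsi, fA1, fA2, fA3, fA4, fH0, fH1, fSim, fInc, Ok, ok_alls, a, fImp, fIff, fEx, fAllC,
    fLt, fMem, fPM, fCol, h1, h2, h3, hc, implies_true, and_self]

end Hanf
end PartPD

section PartPE
open FirstOrder Cardinal
namespace Hanf
variable {Λ : Type}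

theorem Good.not_bgo {M : Type} [(LV Λ).Structure M] (hG : Good Λ M) [LinearOrder M]
    [WellFoundedLT M] (hlt : ∀ x y : M, mLt Λ x y ↔ x < y) (a : M) :
    ¬ BGo Λ {x : M // x < a} := by
  intro hB
  let f : Finset {x : M // x < a} → Set Λ := fun w =>
    {i | mCol i a (fun k : Fin w.card => ((w.orderEmbOfFin rfl k : {x : M // x < a}) : M))}
  have hf : ∀ (w : Finset {x : M // x < a}) (n : ℕ) (hn : w.card = n) (i : Λ), i ∈ f w ↔
      mCol i a (fun k : Fin n => ((w.orderEmbOfFin hn k : {x : M // x < a}) : M)) := by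
    intro w n hn i
    subst hn
    rfl
  obtain ⟨γ, hγ⟩ := hB f
  have key : ∀ (J : Type) [LinearOrder J] (h : J ↪o {x : M // x < a})
      (_ : ∀ u : Finset J, f (u.map h.toEmbedding) = γ u.card) (n : ℕ) (y : Fin n → M),
      mInc Λ (Set.range fun j => (h j : M)) y → ∀ i : Λ, mCol i a y ↔ i ∈ γ n := by
    intro J _ h hh n y hy i
    choose j hj using hy.1
    have hjm : StrictMono j := by
      intro k l hkl
      have h1 := (hlt _ _).1 (hy.2 k l hkl)
      rw [← hj k, ← hj l] at h1
      exact h.lt_iff_lt.1 h1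
    let u : Finset J := Finset.univ.map ⟨j, hjm.injective⟩
    have hu : u.card = n := by simp [u]
    have hw : (u.map h.toEmbedding).card = n := by simp [hu]
    have h2 := hh u
    rw [hu] at h2
    rw [← h2, hf _ n hw]
    have h3 : (fun k => h (j k)) = (u.map h.toEmbedding).orderEmbOfFin hw := by
      refine Finset.orderEmbOfFin_unique hw ?_ (h.strictMono.comp hjm)
      intro k
      simp [u]
    rw [← h3]
    have h4 : (fun k => ((h (j k) : {x : M // x < a}) : M)) = y := funext hj
    rw [h4]
  obtain ⟨h0, hh0⟩ := hγ ℕ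
  have hH0 : mH0 Λ a (Set.range fun j => (h0 j : M)) := by
    refine ⟨?_, ⟨_, 0, rfl⟩, ?_, ?_⟩
    · rintro _ ⟨j, rfl⟩
      exact (hlt _ _).2 (h0 j).2
    · rintro _ ⟨j, rfl⟩
      exact ⟨_, ⟨j + 1, rfl⟩, (hlt _ _).2 (h0.strictMono (Nat.lt_succ_self j))⟩
    · intro n i x y hx hy
      rw [key ℕ h0 hh0 n x hx, key ℕ h0 hh0 n y hy]
  obtain ⟨b, ⟨B, hBc, hB'⟩, hb⟩ := hG.main a _ (Set.countable_range _) hH0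
  have : Countable {x : M // x < b} :=
    (hBc.mono (fun x (hx : x ∈ {x : M | x < b}) => hB' x ((hlt _ _).2 hx))).to_subtype
  obtain ⟨h1, hh1⟩ := hγ {x : M // x < b}
  refine hb (Set.range fun j => (h1 j : M)) (Set.countable_range _)
    (Set.range fun j : {x : M // x < b} => mP Λ j.1 (h1 j : M)) (Set.countable_range _)
    ⟨?_, ?_, ?_, ?_⟩
  · rintro _ ⟨j, rfl⟩
    exact (hlt _ _).2 (h1 j).2
  · intro n i x y hx hy
    rw [key _ h1 hh1 n x hx, key ℕ h0 hh0 n y hy]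
  · intro x hx
    exact ⟨_, ⟨⟨x, (hlt _ _).1 hx⟩, rfl⟩, ⟨⟨x, (hlt _ _).1 hx⟩, rfl⟩⟩
  · rintro x x' y y' ⟨⟨hx, -⟩, ⟨j, hj⟩, ⟨j', hj'⟩⟩
    obtain ⟨e1, e2⟩ := hG.inj _ _ _ _ hj
    obtain ⟨e3, e4⟩ := hG.inj _ _ _ _ hj'
    subst e1; subst e2; subst e3; subst e4
    exact (hlt _ _).2 (h1.strictMono ((hlt _ _).1 hx))

theorem Good.card_le {M : Type} [(LV Λ).Structure M] (hG : Good Λ M) {D : Type} [LinearOrder D]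
    [WellFoundedLT D] (hD : BGo Λ D) : #M ≤ #D := by
  classical
  have : IsStrictTotalOrder M (mLt Λ) :=
    { irrefl := hG.irr
      trans := hG.tr
      trichotomous := fun x y => hG.tri x y }
  let _ : LinearOrder M := linearOrderOfSTO (mLt Λ)
  have hlt : ∀ x y : M, mLt Λ x y ↔ x < y := fun _ _ => Iff.rfl
  have hwf : WellFoundedLT M := by
    constructor
    rw [RelEmbedding.wellFounded_iff_isEmpty]
    refine ⟨fun s => ?_⟩
    obtain ⟨x, ⟨n, rfl⟩, hx⟩ := hG.wf (Set.range s) (Set.countable_range _) ⟨_, 0, rfl⟩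
    exact hx _ ⟨n + 1, rfl⟩ ((hlt _ _).2 (s.map_rel_iff.2 (Nat.lt_succ_self n)))
  rcases lt_or_ge (Ordinal.type (α := D) (· < ·)) (Ordinal.type (α := M) (· < ·)) with h | h
  · exfalso
    obtain ⟨s⟩ := Ordinal.type_lt_iff.1 h
    refine hG.not_bgo hlt s.top (hD.mono (OrderEmbedding.ofStrictMono
      (fun x => (⟨s x, s.lt_top x⟩ : {x : M // x < s.top})) ?_))
    intro x y hxy
    exact s.map_rel_iff.2 hxy
  · obtain ⟨s⟩ := Ordinal.type_le_iff'.1 h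
    exact mk_le_of_injective s.injective

theorem exists_good {D : Type} [LinearOrder D] [WellFoundedLT D] (hD : BGo Λ D)
    (hmin : ∀ a : D, ¬ BGo Λ {x : D // x < a}) :
    ∃ S : (LV Λ).Structure D, @Good Λ D S := by
  classical
  obtain ⟨eN⟩ := hD.embeds ℕ
  have : Infinite D := Infinite.of_injective _ eN.injective
  obtain ⟨pr⟩ : Nonempty (D × D ↪ D) := by
    rw [← Cardinal.le_def, mk_prod, lift_id, Cardinal.mul_eq_self (aleph0_le_mk D)]
  have hbad : ∀ a : D, ∃ f : Finset {x : D // x < a} → Set Λ, ∀ γ : ℕ → Set Λ,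
      ∃ (J : Type) (_ : LinearOrder J) (_ : WellFoundedLT J) (_ : Countable J),
        ∀ h : J ↪o {x : D // x < a}, ∃ u : Finset J, f (u.map h.toEmbedding) ≠ γ u.card := by
    intro a
    have := hmin a
    unfold BGo at this
    push Not at this
    obtain ⟨f, hf⟩ := this
    refine ⟨f, fun γ => ?_⟩
    obtain ⟨J, i1, i2, i3, h⟩ := hf γ
    exact ⟨J, i1, i2, i3, h⟩
  choose f hf using hbad
  let S : (LV Λ).Structure D :=
    { funMap := fun {n} _ v => if h : 2 ≤ n then pr (v ⟨0, by omega⟩, v ⟨1, by omega⟩) else eN 0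
      RelMap := fun {n} r v => Sum.elim
        (fun i : Λ => ∃ h : 0 < n, i ∈ f (v ⟨0, h⟩)
          ((Finset.univ.image v).subtype (fun x => x < v ⟨0, h⟩)))
        (fun _ : Unit => ∃ h : 2 ≤ n, v ⟨0, by omega⟩ < v ⟨1, by omega⟩) r }
  refine ⟨S, ?_⟩
  have hlt : ∀ x y : D, mLt Λ x y ↔ x < y := by
    intro x y
    constructor
    · rintro ⟨_, h⟩
      exact h
    · intro h
      exact ⟨le_rfl, h⟩
  have hP : ∀ x y : D, mP Λ x y = pr (x, y) := fun x y => rfl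
  have hC : ∀ (i : Λ) (n : ℕ) (a : D) (x : Fin n → D) (u : Finset {x : D // x < a}),
      (∀ z : {x : D // x < a}, z ∈ u ↔ ∃ k, x k = z) → (mCol i a x ↔ i ∈ f a u) := by
    intro i n a x u hu
    have h2 : (Finset.univ.image (Fin.cons a x : Fin (n + 1) → D)).subtype (fun x => x < a) = u := by
      ext z
      rw [hu z, Finset.mem_subtype, Finset.mem_image]
      constructor
      · rintro ⟨k, -, hk⟩
        revert hk
        refine Fin.cases ?_ ?_ k
        · intro hk
          exact absurd z.2 (by rw [← hk]; simp)
        · intro k hk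
          exact ⟨k, by simpa using hk⟩
      · rintro ⟨k, hk⟩
        exact ⟨k.succ, Finset.mem_univ _, by simpa using hk⟩
    rw [← h2]
    constructor
    · rintro ⟨_, h⟩
      exact h
    · intro h
      exact ⟨Nat.succ_pos n, h⟩
  constructor
  · intro x; rw [hlt]; exact lt_irrefl x
  · intro x y z; rw [hlt, hlt, hlt]; exact lt_trans
  · intro x y; rw [hlt, hlt]; intro h h'; exact le_antisymm (not_lt.1 h') (not_lt.1 h)
  · rintro T - hT
    refine ⟨WellFounded.min (wellFounded_lt (α := D)) T hT, WellFounded.min_mem _ _ _, ?_⟩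
    intro y hy
    rw [hlt]
    exact WellFounded.not_lt_min _ _ hy
  · intro x y x' y' h
    rw [hP, hP] at h
    simpa using pr.injective h
  · rintro a Y0 - ⟨h1, ⟨y0, hy0⟩, h2, h3⟩
    have : Nonempty Y0 := ⟨⟨y0, hy0⟩⟩
    have : NoMaxOrder Y0 := ⟨fun x => by
      obtain ⟨y, hy, hxy⟩ := h2 x.1 x.2
      exact ⟨⟨y, hy⟩, (hlt _ _).1 hxy⟩⟩
    obtain ⟨s, hs⟩ := Nat.exists_strictMono Y0
    let sa : ℕ → {x : D // x < a} := fun n => ⟨(s n).1, (hlt _ _).1 (h1 _ (s n).2)⟩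
    obtain ⟨J, _, _, _, hJ⟩ := hf a (fun n => f a ((Finset.range n).image sa))
    obtain ⟨e⟩ := hD.embeds (WithTop J)
    let g : InitialSeg (fun x y : WithTop J => x < y) (fun x y : D => x < y) :=
      e.ltEmbedding.collapse
    have hgm : ∀ x y : WithTop J, x < y → g x < g y := fun x y h => g.map_rel_iff.2 h
    refine ⟨g ⊤, ⟨Set.range g, Set.countable_range _, ?_⟩, ?_⟩
    · intro x hx
      obtain ⟨j, hj⟩ := g.mem_range_of_rel ((hlt _ _).1 hx)
      exact ⟨j, hj⟩
    · rintro Y - Z - ⟨k1, k2, k3, k4⟩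
      choose! y hyY hyZ using k3
      have hgt : ∀ j : J, mLt Λ (g (j : WithTop J)) (g ⊤) := fun j =>
        (hlt _ _).2 (hgm _ _ (WithTop.coe_lt_top j))
      let h : J ↪o {x : D // x < a} := OrderEmbedding.ofStrictMono
        (fun j => ⟨y (g (j : WithTop J)), (hlt _ _).1 (k1 _ (hyY _ (hgt j)))⟩) (by
          intro j j' hjj
          have := k4 (g (j : WithTop J)) (g (j' : WithTop J)) (y (g (j : WithTop J)))
            (y (g (j' : WithTop J))) ⟨⟨(hlt _ _).2 (hgm _ _ (WithTop.coe_lt_coe.2 hjj)), hgt j'⟩,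
              hyZ _ (hgt j), hyZ _ (hgt j')⟩
          exact (hlt _ _).1 this)
      obtain ⟨u, hu⟩ := hJ h
      apply hu
      ext i
      have c1 := hC i u.card a (fun k => (h (u.orderEmbOfFin rfl k) : D)) (u.map h.toEmbedding) (by
        intro z
        rw [Finset.mem_map]
        constructor
        · rintro ⟨j, hj, rfl⟩
          have : j ∈ Set.range (u.orderEmbOfFin rfl) := by
            rw [Finset.range_orderEmbOfFin]; exact hj
          obtain ⟨k, rfl⟩ := this
          exact ⟨k, rfl⟩
        · rintro ⟨k, hk⟩
          exact ⟨_, Finset.orderEmbOfFin_mem u rfl k, Subtype.ext hk⟩)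
      have c2 := hC i u.card a (fun k => (s k.1 : D)) ((Finset.range u.card).image sa) (by
        intro z
        rw [Finset.mem_image]
        constructor
        · rintro ⟨j, hj, rfl⟩
          exact ⟨⟨j, Finset.mem_range.1 hj⟩, rfl⟩
        · rintro ⟨k, hk⟩
          exact ⟨k.1, Finset.mem_range.2 k.2, Subtype.ext hk⟩)
      rw [← c1, ← c2]
      refine k2 _ i _ _ ⟨fun k => hyY _ (hgt _), fun k l hkl => (hlt _ _).2 ?_⟩
        ⟨fun k => (s k.1).2, fun k l hkl => (hlt _ _).2 (hs hkl)⟩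
      exact h.strictMono ((u.orderEmbOfFin rfl).strictMono hkl)

theorem bgo_of_partition {μ χ : Cardinal.{0}} (hχ : χ = #(Set Λ)) (h : BGPartition μ χ) :
    BGo Λ μ.ord.ToType := by
  classical
  obtain ⟨c⟩ : Nonempty (Set Λ ≃ Set.Iio χ.ord) := by
    have h1 : #(χ.ord.ToType) = #(Set Λ) := by rw [Cardinal.mk_toType, card_ord, hχ]
    obtain ⟨e1⟩ := Cardinal.eq.1 h1
    exact ⟨e1.symm.trans Ordinal.ToType.mk.toEquiv.symm⟩
  let m : Set.Iio μ.ord ≃o μ.ord.ToType := Ordinal.ToType.mk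
  intro f
  obtain ⟨γ, hγ⟩ := h (fun w => c (f (w.map m.toEquiv.toEmbedding)))
  refine ⟨fun n => c.symm (γ n), ?_⟩
  intro J _ _ _
  let α : Ordinal.{0} := Ordinal.type (α := J) (· < ·)
  have hα : α < (Cardinal.aleph.{0} 1).ord := by
    rw [Cardinal.lt_ord, Ordinal.card_type]
    exact lt_of_le_of_lt (mk_le_aleph0 (α := J)) Cardinal.aleph0_lt_aleph_one
  obtain ⟨Y, ⟨e⟩, hY⟩ := hγ α hα
  let i1 : J ≃o Set.Iio α := OrderIso.ofRelIsoLT (Ordinal.enum (α := J) (· < ·)).symm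
  let h1 : J ↪o Set.Iio μ.ord := (i1.trans e).toOrderEmbedding.trans (OrderEmbedding.subtype Y)
  refine ⟨h1.trans m.toOrderEmbedding, fun u => ?_⟩
  have := hY u.card (u.map h1.toEmbedding) (by
    intro x hx
    simp only [Finset.coe_map, Set.mem_image] at hx
    obtain ⟨j, -, rfl⟩ := hx
    exact ((i1.trans e) j).2) (by simp)
  show _ = c.symm (γ u.card)
  rw [← this, Equiv.symm_apply_apply, Finset.map_map]
  rfl

end Hanf
end PartPE

section PartPF
open FirstOrder Cardinal
namespace Hanf

theorem hanf_main
    (hBG : ∀ χ : Cardinal.{0}, ∃ μ : Cardinal.{0}, BGPartition μ χ) :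
    ∀ lam : Cardinal.{0}, ℵ₀ ≤ lam →
      hanfNum (LwoInf (Order.succ lam)) < hanfNum (LcInf (Order.succ lam)) := by
  intro lam hl
  obtain ⟨Λ, hΛ⟩ : ∃ Λ : Type, #Λ = lam := ⟨Quotient.out lam, Cardinal.mk_out lam⟩
  obtain ⟨μ, hμ⟩ := hBG #(Set Λ)
  have hex : ∃ δ : Ordinal.{0}, BGo Λ δ.ToType := ⟨_, bgo_of_partition rfl hμ⟩
  let P : Set Ordinal.{0} := {δ | BGo Λ δ.ToType}
  obtain ⟨δ, hδ, hmin⟩ : ∃ δ ∈ P, ∀ ε ∈ P, ¬ ε < δ := (wellFounded_lt (α := Ordinal.{0})).has_min P hex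
  have hmin' : ∀ a : δ.ToType, ¬ BGo Λ {x : δ.ToType // x < a} := by
    intro a ha
    let o : Ordinal.{0} := Ordinal.type (α := {x : δ.ToType // x < a}) (· < ·)
    have ho : o < δ := by
      have h1 := Ordinal.type_lt_iff.2 ⟨PrincipalSeg.ofElement (fun x y : δ.ToType => x < y) a⟩
      rw [Ordinal.type_toType] at h1
      exact h1
    have h2 : o ≤ Ordinal.type (α := o.ToType) (· < ·) := by rw [Ordinal.type_toType]
    obtain ⟨s⟩ := Ordinal.type_le_iff'.1 h2
    exact hmin o (ha.mono (OrderEmbedding.ofStrictMono s (fun x y h => s.map_rel_iff.2 h))) ho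
  have hwo : hanfNum (LwoInf (Order.succ lam)) ≤ #δ.ToType := wo_bound hl hΛ hδ
  have hle : ∀ (M : Type) (S : (LV Λ).Structure M), @Sat (LV Λ) M S fPsi → #M ≤ #δ.ToType := by
    intro M S hS
    rcases isEmpty_or_nonempty M with hM | ⟨⟨m⟩⟩
    · rw [mk_eq_zero]; exact Cardinal.zero_le _
    · exact ((eval_psi _ _ _).1 (hS (fun _ => m) (fun _ => ∅) (fun _ _ _ => False))).card_le hδ
  obtain ⟨S, hS⟩ := exists_good hδ hmin'
  have hbd : BddSpec (fPsi (Λ := Λ)) :=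
    ⟨Order.succ #δ.ToType, fun M S h => Order.lt_succ_of_le (hle M S h)⟩
  have hval : Order.succ #δ.ToType ≤ hanfVal (fPsi (Λ := Λ)) := by
    refine le_csSup ⟨Order.succ #δ.ToType, ?_⟩ ⟨δ.ToType, S, fun va vs vr => (eval_psi va vs vr).2 hS, rfl⟩
    rintro _ ⟨M, S', h, rfl⟩
    exact Order.succ_le_succ (hle M S' h)
  have hnum : hanfVal (fPsi (Λ := Λ)) ≤ hanfNum (LcInf (Order.succ lam)) :=
    le_csSup (bddAbove_hanf hl (fun h => h) (fun h => h) (fun h => h) rfl)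
      ⟨LV Λ, fPsi, sent_psi, ok_psi hl hΛ, hbd, rfl⟩
  exact hwo.trans_lt ((Order.lt_succ _).trans_le (hval.trans hnum))

end Hanf
end PartPF

namespace Hanf

/-- Assume that for every cardinal `χ` there is a cardinal `μ` with
`μ →_{BG} (c)^{<ω}_χ`. Then for every infinite cardinal `λ`,
`h(L^{wo}_{λ⁺,ω}) < h(L^c_{λ⁺,ω})`. -/
theorem hanf_wo_succ_lt_hanf_c_succ
    (hBG : ∀ χ : Cardinal.{0}, ∃ μ : Cardinal.{0}, BGPartition μ χ) :
    ∀ lam : Cardinal.{0}, ℵ₀ ≤ lam →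
      hanfNum (LwoInf (Order.succ lam)) < hanfNum (LcInf (Order.succ lam)) := by
  exact hanf_main hBG

end Hanf
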